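/- arXiv:2104.01134 — 5 statements merged into one kernel-verified Lean document; each statement's English description precedes it below -/
import Mathlib

section
/- Let $X_n$ be the number of crossings in a uniformly random chord diagram of size $n$. Then $E X_n = \frac{n(n-1)}{6}$ and $\mathrm{Var}(X_n) = \frac{n(n-1)(n+3)}{45}$. -/
open MeasureTheory ProbabilityTheory Filter
open scoped Nat

instance {N : ℕ} : MeasurableSpace (Equiv.Perm (Fin N)) := ⊤

/-- A chord diagram of size `n` is a fixed-point-free involution of `{1,…,2n}`. -/
def IsChordDiagram {n : ℕ} (π : Equiv.Perm (Fin (2 * n))) : Prop :=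
  (∀ i, π (π i) = i) ∧ ∀ i, π i ≠ i

/-- The uniform probability measure on chord diagrams of size `n`. -/
noncomputable def uniformCD (n : ℕ) : Measure (Equiv.Perm (Fin (2 * n))) :=
  uniformOn {π | IsChordDiagram π}

/-- The number of crossings: quadruples `i < j < k < l` with `π i = k` and `π j = l`. -/
def crossings {n : ℕ} (π : Equiv.Perm (Fin (2 * n))) : ℕ :=
  ((Finset.univ : Finset (Fin (2 * n) × Fin (2 * n) × Fin (2 * n) × Fin (2 * n))).filter
    (fun q => q.1 < q.2.1 ∧ q.2.1 < q.2.2.1 ∧ q.2.2.1 < q.2.2.2 ∧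
      π q.1 = q.2.2.1 ∧ π q.2.1 = q.2.2.2)).card

/-- The number of simple chords: indices `k` with `π k = k + 1 (mod 2n)`. -/
def simpleChords {n : ℕ} (π : Equiv.Perm (Fin (2 * n))) : ℕ :=
  (Finset.univ.filter (fun k => π k = finRotate (2 * n) k)).card

/-- The indicator of `p < r < q < s`. -/
def leadCross {α : Type*} [LinearOrder α] (p q r s : α) : ℕ :=
  if p < r ∧ r < q ∧ q < s then 1 else 0

/-- The indicator of the event that the chords `{p, q}` and `{r, s}` cross. -/
def chordCross {α : Type*} [LinearOrder α] (p q r s : α) : ℕ :=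
  leadCross p q r s + leadCross q p r s + leadCross p q s r + leadCross q p s r +
    (leadCross r s p q + leadCross s r p q + leadCross r s q p + leadCross s r q p)

section ChordCross

variable {α β : Type*} [LinearOrder α] [LinearOrder β]

lemma chordCross_comm (p q r s : α) : chordCross p q r s = chordCross r s p q := by
  unfold chordCross; ring

lemma chordCross_self (p q : α) : chordCross p q p q = 0 := by
  simp [chordCross, leadCross]

lemma chordCross_mul_self (p q r s : α) :
    chordCross p q r s * chordCross p q r s = chordCross p q r s := by
  have h : chordCross p q r s = 0 ∨ chordCross p q r s = 1 := by
    unfold chordCross leadCross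
    grind (splits := 40)
  rcases h with h | h <;> simp [h]

lemma chordCross_add_add {p q r s : α} (hpq : p ≠ q) (hpr : p ≠ r) (hps : p ≠ s)
    (hqr : q ≠ r) (hqs : q ≠ s) (hrs : r ≠ s) :
    chordCross p q r s + chordCross p r q s + chordCross p s r q = 1 := by
  unfold chordCross leadCross
  rcases hpq.lt_or_gt with h₁ | h₁ <;> rcases hpr.lt_or_gt with h₂ | h₂ <;>
  rcases hps.lt_or_gt with h₃ | h₃ <;> rcases hqr.lt_or_gt with h₄ | h₄ <;>
  rcases hqs.lt_or_gt with h₅ | h₅ <;> rcases hrs.lt_or_gt with h₆ | h₆ <;>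
  first
  | (exfalso; order)
  | simp [h₁, h₂, h₃, h₄, h₅, h₆, h₁.not_gt, h₂.not_gt, h₃.not_gt, h₄.not_gt, h₅.not_gt,
      h₆.not_gt]

lemma chordCross_strictMono {f : α → β} (hf : StrictMono f) (p q r s : α) :
    chordCross (f p) (f q) (f r) (f s) = chordCross p q r s := by
  simp [chordCross, leadCross, hf.lt_iff_lt]

end ChordCross

lemma sum_perm_fin_six :
    ∑ ρ : Equiv.Perm (Fin 6), chordCross (ρ 0) (ρ 1) (ρ 2) (ρ 3) *
      chordCross (ρ 0) (ρ 1) (ρ 4) (ρ 5) = 96 := by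
  decide +kernel

section PermSums

variable {N : ℕ}

lemma sum_chordCross_perm_fin_six (w : Fin 6 → Fin N) (hw : Function.Injective w) :
    ∑ ρ : Equiv.Perm (Fin 6), chordCross (w (ρ 0)) (w (ρ 1)) (w (ρ 2)) (w (ρ 3)) *
      chordCross (w (ρ 0)) (w (ρ 1)) (w (ρ 4)) (w (ρ 5)) = 96 := by
  have hmono : StrictMono (w ∘ Tuple.sort w) :=
    (Tuple.monotone_sort w).strictMono_of_injective (hw.comp (Tuple.sort w).injective)
  rw [← Equiv.sum_comp (Equiv.mulLeft (Tuple.sort w)), ← sum_perm_fin_six]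
  refine Finset.sum_congr rfl fun ρ _ => ?_
  have h := chordCross_strictMono hmono
  simp only [Function.comp_apply] at h
  simp only [Equiv.coe_mulLeft, Equiv.Perm.mul_apply, h]

lemma sum_chordCross_mul_chordCross_of_shared (z : Fin 6 → Fin N)
    (hz : Function.Injective z) :
    15 * ∑ σ : Equiv.Perm (Fin N), chordCross (σ (z 0)) (σ (z 1)) (σ (z 2)) (σ (z 3)) *
      chordCross (σ (z 0)) (σ (z 1)) (σ (z 4)) (σ (z 5)) = 2 * N ! := by
  have hinv (ρ : Equiv.Perm (Fin 6)) :
      ∑ σ : Equiv.Perm (Fin N), chordCross (σ (z 0)) (σ (z 1)) (σ (z 2)) (σ (z 3)) *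
        chordCross (σ (z 0)) (σ (z 1)) (σ (z 4)) (σ (z 5)) =
      ∑ σ : Equiv.Perm (Fin N),
        chordCross (σ (z (ρ 0))) (σ (z (ρ 1))) (σ (z (ρ 2))) (σ (z (ρ 3))) *
        chordCross (σ (z (ρ 0))) (σ (z (ρ 1))) (σ (z (ρ 4))) (σ (z (ρ 5))) := by
    rw [← Equiv.sum_comp (Equiv.mulRight (ρ.viaFintypeEmbedding ⟨z, hz⟩))]
    have happly (i : Fin 6) : ρ.viaFintypeEmbedding ⟨z, hz⟩ (z i) = z (ρ i) :=
      ρ.viaFintypeEmbedding_apply_image ⟨z, hz⟩ i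
    simp only [Equiv.coe_mulRight, Equiv.Perm.mul_apply, happly]
  have h : ∑ _ρ : Equiv.Perm (Fin 6), ∑ σ : Equiv.Perm (Fin N),
      chordCross (σ (z 0)) (σ (z 1)) (σ (z 2)) (σ (z 3)) *
        chordCross (σ (z 0)) (σ (z 1)) (σ (z 4)) (σ (z 5)) =
      ∑ _σ : Equiv.Perm (Fin N), 96 := by
    rw [Finset.sum_congr rfl fun ρ _ => hinv ρ, Finset.sum_comm]
    exact Finset.sum_congr rfl fun σ _ =>
      sum_chordCross_perm_fin_six (fun i => σ (z i)) (σ.injective.comp hz)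
  simp only [Finset.sum_const, Finset.card_univ, Fintype.card_perm, Fintype.card_fin,
    smul_eq_mul] at h
  rw [show 6 ! = 720 from rfl] at h
  omega

lemma three_mul_sum_chordCross {p q r s : Fin N} (hpq : p ≠ q) (hpr : p ≠ r) (hps : p ≠ s)
    (hqr : q ≠ r) (hqs : q ≠ s) (hrs : r ≠ s) (g : Equiv.Perm (Fin N) → ℕ)
    (hg₁ : ∀ σ, g (σ * Equiv.swap q r) = g σ) (hg₂ : ∀ σ, g (σ * Equiv.swap q s) = g σ) :
    3 * ∑ σ : Equiv.Perm (Fin N), chordCross (σ p) (σ q) (σ r) (σ s) * g σ = ∑ σ, g σ := by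
  have h₁ : ∑ σ : Equiv.Perm (Fin N), chordCross (σ p) (σ q) (σ r) (σ s) * g σ =
      ∑ σ : Equiv.Perm (Fin N), chordCross (σ p) (σ r) (σ q) (σ s) * g σ := by
    rw [← Equiv.sum_comp (Equiv.mulRight (Equiv.swap q r))]
    simp [hg₁, Equiv.swap_apply_of_ne_of_ne, hpq, hpr, hqs.symm, hrs.symm]
  have h₂ : ∑ σ : Equiv.Perm (Fin N), chordCross (σ p) (σ q) (σ r) (σ s) * g σ =
      ∑ σ : Equiv.Perm (Fin N), chordCross (σ p) (σ s) (σ r) (σ q) * g σ := by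
    rw [← Equiv.sum_comp (Equiv.mulRight (Equiv.swap q s))]
    simp [hg₂, Equiv.swap_apply_of_ne_of_ne, hpq, hps, hqr.symm, hrs]
  calc _ = ∑ σ : Equiv.Perm (Fin N), (chordCross (σ p) (σ q) (σ r) (σ s) +
          chordCross (σ p) (σ r) (σ q) (σ s) + chordCross (σ p) (σ s) (σ r) (σ q)) * g σ := by
        simp only [add_mul, Finset.sum_add_distrib, ← h₁, ← h₂]
        ring
    _ = _ := by
        refine Finset.sum_congr rfl fun σ _ => ?_
        rw [chordCross_add_add, one_mul] <;> simpa using by assumption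

end PermSums

lemma sum_pairs_moments {Ω ι : Type*} [Fintype Ω] [Fintype ι] [DecidableEq ι]
    (K : ι → ι → Ω → ℝ) (hself : ∀ a ω, K a a ω = 0) (hsymm : ∀ a b ω, K a b ω = K b a ω)
    (hsq : ∀ a b ω, K a b ω * K a b ω = K a b ω)
    (hone : ∀ a b, a ≠ b → ∑ ω, K a b ω = Fintype.card Ω * (1 / 3))
    (hshared : ∀ a b c, a ≠ b → a ≠ c → b ≠ c →
      ∑ ω, K a b ω * K a c ω = Fintype.card Ω * (2 / 15))
    (hdisj : ∀ a b c d, a ≠ b → c ≠ d → a ≠ c → a ≠ d → b ≠ c → b ≠ d →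
      ∑ ω, K a b ω * K c d ω = Fintype.card Ω * (1 / 9)) :
    (∑ ω, ∑ a, ∑ b, K a b ω =
      Fintype.card Ω * ((Fintype.card ι : ℝ) * (Fintype.card ι - 1) / 3)) ∧
    ∑ ω, (∑ a, ∑ b, K a b ω) ^ 2 = Fintype.card Ω * ((Fintype.card ι : ℝ) *
      (Fintype.card ι - 1) * ((Fintype.card ι : ℝ) ^ 2 / 9 - Fintype.card ι / 45 + 12 / 45)) := by
  have hpair (a b : ι) : ∑ ω, K a b ω =
      Fintype.card Ω * (1 / 3 - if a = b then 1 / 3 else 0) := by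
    rcases eq_or_ne a b with rfl | h
    · simp [hself]
    · simp [hone a b h, h]
  have hcov (a b c d : ι) (hab : a ≠ b) : ∑ ω, K a b ω * K c d ω =
      Fintype.card Ω * (1 / 9 + ((if a = c then 1 / 45 else 0) + (if a = d then 1 / 45 else 0) +
        (if b = c then 1 / 45 else 0) + (if b = d then 1 / 45 else 0)) +
        ((if a = c then (if b = d then 8 / 45 else 0) else 0) +
        (if a = d then (if b = c then 8 / 45 else 0) else 0)) -
        ((if c = d then 1 / 9 else 0) + (if a = c then (if c = d then 2 / 45 else 0) else 0) +
        (if b = c then (if c = d then 2 / 45 else 0) else 0))) := by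
    rcases eq_or_ne c d with rfl | hcd
    · simp only [hself, mul_zero, Finset.sum_const_zero]
      split_ifs <;> first | (exfalso; grind) | norm_num
    by_cases hac : a = c
    · subst hac
      by_cases hbd : b = d
      · subst hbd
        simp only [hsq, hone a b hab]
        simp [hab, hab.symm]
        norm_num
      · simp only [hshared a b d hab hcd hbd]
        simp [hab.symm, hcd, hbd]
        norm_num
    by_cases had : a = d
    · subst had
      simp only [hsymm c a]
      by_cases hbc : b = c
      · subst hbc
        simp only [hsq, hone a b hab]
        simp [hab, hab.symm]
        norm_num
      · simp only [hshared a b c hab hac hbc]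
        simp [hab.symm, hcd, hbc, hac]
        norm_num
    simp only [hsymm a b]
    by_cases hbc : b = c
    · subst hbc
      simp only [hshared b a d hab.symm hcd had]
      simp [hab, hcd, had]
      norm_num
    by_cases hbd : b = d
    · subst hbd
      simp only [hsymm c b, hshared b a c hab.symm hbc hac]
      simp [hab, hcd, hac, hbc]
      norm_num
    rw [hdisj b a c d hab.symm hcd hbc hbd hac had]
    simp [hac, hbc, had, hbd, hcd]
  constructor
  · rw [Finset.sum_comm]
    simp_rw [Finset.sum_comm (s := (Finset.univ : Finset Ω)), hpair, ← Finset.mul_sum]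
    simp only [Finset.sum_sub_distrib, Finset.sum_ite_eq, Finset.mem_univ, if_true,
      Finset.sum_const, Finset.card_univ, nsmul_eq_mul]
    ring
  · have hrow (a b : ι) : ∑ c, ∑ d, ∑ ω, K a b ω * K c d ω =
        (if a = b then 0 else 1) * (Fintype.card Ω * ((Fintype.card ι : ℝ) ^ 2 / 9 -
          Fintype.card ι / 45 + 12 / 45)) := by
      rcases eq_or_ne a b with rfl | hab
      · simp [hself]
      · simp only [hcov a b _ _ hab, ← Finset.mul_sum]
        simp only [Finset.sum_sub_distrib, Finset.sum_add_distrib, Finset.sum_ite_eq,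
          Finset.mem_univ, if_true, Finset.sum_const, Finset.card_univ, nsmul_eq_mul,
          Finset.sum_ite_irrel, mul_zero, ← Finset.mul_sum, hab, if_false]
        ring
    have hexp : ∑ ω, (∑ a, ∑ b, K a b ω) ^ 2 = ∑ a, ∑ b, ∑ c, ∑ d, ∑ ω, K a b ω * K c d ω := by
      simp_rw [sq, Finset.sum_mul, Finset.mul_sum]
      rw [Finset.sum_comm]
      simp_rw [Finset.sum_comm (s := (Finset.univ : Finset Ω))]
    have hcount : ∑ a : ι, ∑ b : ι, (if a = b then (0 : ℝ) else 1) =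
        (Fintype.card ι : ℝ) * (Fintype.card ι - 1) := by
      have (a b : ι) : (if a = b then (0 : ℝ) else 1) = 1 - if a = b then 1 else 0 := by
        split_ifs <;> simp
      simp [this, Finset.sum_sub_distrib]
      ring
    rw [hexp]
    simp_rw [hrow, ← Finset.sum_mul]
    rw [hcount]
    ring

section ChordDiagram

variable {n : ℕ}

lemma crossings_eq_sum (τ : Equiv.Perm (Fin (2 * n))) :
    crossings τ = ∑ x, ∑ y, leadCross x (τ x) y (τ y) := by
  unfold crossings
  rw [Finset.card_filter]
  simp only [Fintype.sum_prod_type]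
  refine Finset.sum_congr rfl fun x _ => Finset.sum_congr rfl fun y _ => ?_
  rw [Finset.sum_eq_single (τ x) (by intro k _ hk; simp [hk.symm]) (by simp),
    Finset.sum_eq_single (τ y) (by intro k _ hk; simp [hk.symm]) (by simp)]
  simp [leadCross]

lemma IsChordDiagram.sum_eq {M : Type*} [AddCommMonoid M] {π : Equiv.Perm (Fin (2 * n))}
    (hπ : IsChordDiagram π) (f : Fin (2 * n) → M) :
    ∑ x, f x = ∑ a : {a // a < π a}, (f a + f (π a)) := by
  rw [← Fintype.sum_subtype_add_sum_subtype (fun a => a < π a) f, Finset.sum_add_distrib]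
  congr 1
  refine (Equiv.sum_comp (π.subtypeEquiv (p := fun a => a < π a) (q := fun a => ¬a < π a)
    fun a => ?_) fun a => f a).symm
  have := hπ.2 a
  rw [hπ.1]
  grind

lemma IsChordDiagram.card_left {π : Equiv.Perm (Fin (2 * n))} (hπ : IsChordDiagram π) :
    Fintype.card {a // a < π a} = n := by
  have h := hπ.sum_eq fun _ => 1
  simp only [Finset.sum_const, Finset.card_univ, Fintype.card_fin, smul_eq_mul] at h
  omega

lemma IsChordDiagram.conj {π : Equiv.Perm (Fin (2 * n))} (hπ : IsChordDiagram π)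
    (σ : Equiv.Perm (Fin (2 * n))) : IsChordDiagram (σ * π * σ⁻¹) := by
  exact ⟨fun i => by simp [hπ.1], fun i h => hπ.2 (σ⁻¹ i) (σ.injective (by simpa using h))⟩

lemma isChordDiagram_revPerm : IsChordDiagram (Fin.revPerm : Equiv.Perm (Fin (2 * n))) := by
  refine ⟨fun i => by simp, fun i h => ?_⟩
  have := congrArg Fin.val h
  simp only [Fin.revPerm_apply, Fin.val_rev] at this
  omega

lemma IsChordDiagram.two_mul_crossings_conj {π : Equiv.Perm (Fin (2 * n))}
    (hπ : IsChordDiagram π) (σ : Equiv.Perm (Fin (2 * n))) :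
    2 * crossings (σ * π * σ⁻¹) = ∑ a : {a // a < π a}, ∑ b : {a // a < π a},
      chordCross (σ a) (σ (π a)) (σ b) (σ (π b)) := by
  have h : crossings (σ * π * σ⁻¹) = ∑ a : {a // a < π a}, ∑ b : {a // a < π a},
      (leadCross (σ a) (σ (π a)) (σ b) (σ (π b)) + leadCross (σ (π a)) (σ a) (σ b) (σ (π b)) +
        leadCross (σ a) (σ (π a)) (σ (π b)) (σ b) +
        leadCross (σ (π a)) (σ a) (σ (π b)) (σ b)) := by
    have hconj (x : Fin (2 * n)) : (σ * π * σ⁻¹) (σ x) = σ (π x) := by simp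
    have hsum : crossings (σ * π * σ⁻¹) =
        ∑ x, ∑ y, leadCross (σ x) (σ (π x)) (σ y) (σ (π y)) := by
      rw [crossings_eq_sum, ← Equiv.sum_comp σ]
      refine Finset.sum_congr rfl fun x _ => ?_
      rw [← Equiv.sum_comp σ]
      simp only [hconj]
    rw [hsum, hπ.sum_eq]
    refine Finset.sum_congr rfl fun a _ => ?_
    rw [hπ.sum_eq, hπ.sum_eq, ← Finset.sum_add_distrib]
    refine Finset.sum_congr rfl fun b _ => ?_
    simp only [hπ.1]
    ring
  have h' := h
  rw [Finset.sum_comm] at h'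
  rw [two_mul]
  nth_rewrite 2 [h']
  rw [h, ← Finset.sum_add_distrib]
  refine Finset.sum_congr rfl fun a _ => ?_
  rw [← Finset.sum_add_distrib]
  refine Finset.sum_congr rfl fun b _ => ?_
  unfold chordCross
  ring

lemma IsChordDiagram.conj_moments {π : Equiv.Perm (Fin (2 * n))} (hπ : IsChordDiagram π) :
    (∑ σ : Equiv.Perm (Fin (2 * n)), 2 * (crossings (σ * π * σ⁻¹) : ℝ) =
      (2 * n)! * ((n : ℝ) * (n - 1) / 3)) ∧
    ∑ σ : Equiv.Perm (Fin (2 * n)), (2 * (crossings (σ * π * σ⁻¹) : ℝ)) ^ 2 =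
      (2 * n)! * ((n : ℝ) * (n - 1) * ((n : ℝ) ^ 2 / 9 - n / 45 + 12 / 45)) := by
  have hne (a b : {a // a < π a}) : (a : Fin (2 * n)) ≠ π b := by
    intro h
    have h₁ := a.2
    have h₂ := b.2
    rw [h, hπ.1] at h₁
    exact lt_asymm h₁ h₂
  have hne' {a b : {a // a < π a}} (h : a ≠ b) : (a : Fin (2 * n)) ≠ b :=
    fun h' => h (Subtype.ext h')
  have hneπ {a b : {a // a < π a}} (h : a ≠ b) : π a ≠ π b := fun h' => hne' h (π.injective h')
  have key := sum_pairs_moments (Ω := Equiv.Perm (Fin (2 * n)))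
    (fun (a b : {a // a < π a}) σ => (chordCross (σ a) (σ (π a)) (σ b) (σ (π b)) : ℝ))
    (fun a σ => by simp [chordCross_self])
    (fun a b σ => by simp only [chordCross_comm (σ a)])
    (fun a b σ => by exact_mod_cast chordCross_mul_self _ _ _ _)
    (fun a b hab => by
      have := three_mul_sum_chordCross (hne a a) (hne' hab) (hne a b) (hne b a).symm (hneπ hab)
        (hne b b) (fun _ => 1) (fun _ => rfl) (fun _ => rfl)
      simp only [mul_one, Finset.sum_const, Finset.card_univ, smul_eq_mul] at this
      have := congrArg (Nat.cast : ℕ → ℝ) this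
      push_cast at this
      linarith)
    (fun a b c hab hac hbc => by
      have := sum_chordCross_mul_chordCross_of_shared (N := 2 * n)
        ![(a : Fin (2 * n)), π a, b, π b, c, π c] (by
          intro i j hij
          fin_cases i <;> fin_cases j <;>
          simp [hne, (hne _ _).symm, hne' hab, hne' hac, hne' hbc, hne' hab.symm,
            hne' hac.symm, hne' hbc.symm] at hij ⊢)
      have := congrArg (Nat.cast : ℕ → ℝ) this
      simp at this
      rw [Fintype.card_perm, Fintype.card_fin]
      linarith)
    (fun a b c d hab hcd hac had hbc hbd => by
      have h₁ := three_mul_sum_chordCross (hne a a) (hne' hab) (hne a b) (hne b a).symm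
        (hneπ hab) (hne b b) (fun σ => chordCross (σ c) (σ (π c)) (σ d) (σ (π d)))
        (fun σ => by
          simp [Equiv.swap_apply_of_ne_of_ne, hne, (hne' hbc).symm, (hne' hbd).symm,
            (hneπ hac).symm, (hneπ had).symm, (hne _ _).symm])
        (fun σ => by
          simp [Equiv.swap_apply_of_ne_of_ne, hne, (hneπ hac).symm, (hneπ had).symm,
            (hneπ hbc).symm, (hneπ hbd).symm])
      have h₂ := three_mul_sum_chordCross (hne c c) (hne' hcd) (hne c d) (hne d c).symm
        (hneπ hcd) (hne d d) (fun _ => 1) (fun _ => rfl) (fun _ => rfl)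
      simp only [mul_one, Finset.sum_const, Finset.card_univ, smul_eq_mul] at h₂
      have h₁ := congrArg (Nat.cast : ℕ → ℝ) h₁
      have h₂ := congrArg (Nat.cast : ℕ → ℝ) h₂
      push_cast at h₁ h₂
      linarith)
  have hcross (σ : Equiv.Perm (Fin (2 * n))) : 2 * (crossings (σ * π * σ⁻¹) : ℝ) =
      ∑ a : {a // a < π a}, ∑ b : {a // a < π a},
        (chordCross (σ a) (σ (π a)) (σ b) (σ (π b)) : ℝ) := by
    exact_mod_cast hπ.two_mul_crossings_conj σ
  simp_rw [hcross]
  simpa only [hπ.card_left, Fintype.card_perm, Fintype.card_fin] using key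

open Classical in
lemma sum_isChordDiagram_eq (F : Equiv.Perm (Fin (2 * n)) → ℝ) (c : ℝ)
    (hF : ∀ π, IsChordDiagram π →
      ∑ σ : Equiv.Perm (Fin (2 * n)), F (σ * π * σ⁻¹) = (2 * n)! * c) :
    ∑ π with IsChordDiagram (n := n) π, F π =
      (Finset.univ.filter (IsChordDiagram (n := n))).card * c := by
  have hconj (σ : Equiv.Perm (Fin (2 * n))) :
      ∑ π with IsChordDiagram (n := n) π, F (σ * π * σ⁻¹) =
        ∑ π with IsChordDiagram (n := n) π, F π := by
    refine Finset.sum_nbij' (fun π => σ * π * σ⁻¹) (fun π => σ⁻¹ * π * σ) ?_ ?_ ?_ ?_ ?_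
    · intro π hπ
      simp only [Finset.mem_filter, Finset.mem_univ, true_and] at hπ ⊢
      exact hπ.conj σ
    · intro π hπ
      simp only [Finset.mem_filter, Finset.mem_univ, true_and] at hπ ⊢
      simpa using hπ.conj σ⁻¹
    · intro π _
      group
    · intro π _
      group
    · simp
  have h : ∑ σ : Equiv.Perm (Fin (2 * n)), ∑ π with IsChordDiagram (n := n) π,
      F (σ * π * σ⁻¹) = (2 * n)! * ∑ π with IsChordDiagram (n := n) π, F π := by
    simp [hconj, Fintype.card_perm]
  rw [Finset.sum_comm, Finset.sum_congr rfl fun π hπ => hF π (Finset.mem_filter.1 hπ).2] at h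
  simp only [Finset.sum_const, nsmul_eq_mul] at h
  have h0 : ((2 * n)! : ℝ) ≠ 0 := by positivity
  apply mul_left_cancel₀ h0
  linarith

instance {N : ℕ} : DiscreteMeasurableSpace (Equiv.Perm (Fin N)) := ⟨fun _ => trivial⟩

instance : IsProbabilityMeasure (uniformCD n) :=
  isProbabilityMeasure_uniformOn (Set.toFinite _) ⟨_, isChordDiagram_revPerm⟩

open Classical in
lemma integral_uniformCD (F : Equiv.Perm (Fin (2 * n)) → ℝ) (c : ℝ)
    (hF : ∀ π, IsChordDiagram π →
      ∑ σ : Equiv.Perm (Fin (2 * n)), F (σ * π * σ⁻¹) = (2 * n)! * c) :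
    ∫ π, F π ∂uniformCD n = c := by
  have hcard : ((Finset.univ.filter (IsChordDiagram (n := n))).card : ℝ) ≠ 0 := by
    simp only [ne_eq, Nat.cast_eq_zero, Finset.card_eq_zero]
    exact Finset.ne_empty_of_mem
      (Finset.mem_filter.2 ⟨Finset.mem_univ _, isChordDiagram_revPerm⟩)
  have hset : {π : Equiv.Perm (Fin (2 * n)) | IsChordDiagram π} =
      ((Finset.univ.filter (IsChordDiagram (n := n)) : Finset _) : Set _) := by ext; simp
  have hreal (π : Equiv.Perm (Fin (2 * n))) : (uniformCD n).real {π} =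
      if IsChordDiagram π then
        ((Finset.univ.filter (IsChordDiagram (n := n))).card : ℝ)⁻¹ else 0 := by
    rw [uniformCD, hset, ← Finset.coe_singleton, measureReal_def, uniformOn_apply_finset]
    split_ifs with h
    · rw [Finset.inter_singleton_of_mem (by simpa using h)]
      simp
    · rw [Finset.inter_singleton_of_notMem (by simpa using h)]
      simp
  rw [integral_fintype .of_finite]
  simp only [hreal, smul_eq_mul, ite_mul, zero_mul]
  rw [← Finset.sum_filter, ← Finset.mul_sum, sum_isChordDiagram_eq F c hF]
  field_simp

end ChordDiagram

/-- Lemma 2.2: mean and variance of the number of crossings. -/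
theorem crossings_mean_variance (n : ℕ) :
    (∫ π, ((crossings π : ℝ)) ∂uniformCD n) = (n : ℝ) * ((n : ℝ) - 1) / 6 ∧
    variance (fun π => (crossings π : ℝ)) (uniformCD n)
      = (n : ℝ) * ((n : ℝ) - 1) * ((n : ℝ) + 3) / 45 := by
  have hmean : ∫ π, (crossings π : ℝ) ∂uniformCD n = (n : ℝ) * ((n : ℝ) - 1) / 6 := by
    refine integral_uniformCD _ _ fun π hπ => ?_
    have h := hπ.conj_moments.1
    rw [← Finset.mul_sum] at h
    linarith
  refine ⟨hmean, ?_⟩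
  rw [variance_eq_sub .of_discrete, hmean]
  have hsq : ∫ π, (crossings π : ℝ) ^ 2 ∂uniformCD n =
      (n : ℝ) * (n - 1) * ((n : ℝ) ^ 2 / 9 - n / 45 + 12 / 45) / 4 := by
    refine integral_uniformCD _ _ fun π hπ => ?_
    have h := hπ.conj_moments.2
    simp only [mul_pow] at h
    rw [← Finset.mul_sum] at h
    linarith
  simp only [Pi.pow_apply, hsq]
  ring
end

section
/- Let $X$ and $Y$ be random variables on a common probability space with $|X| \leq C_1$ and $|Y| \leq C_2$ almost surely, and let $A$ be an event with $P(A) > 0$ such that, conditional on $A$, $X$ and $Y$ are uncorrelated (i.e. $E[XY \mid A] = E[X \mid A]\, E[Y \mid A]$). Then $|\mathrm{cov}(X,Y)| \leq 4 C_1 C_2 P(A^c)$. -/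
open MeasureTheory ProbabilityTheory

/-- Integrals over a conditioned measure are normalized set integrals. -/
theorem integral_cond_eq_inv_mul_setIntegral {Ω : Type*} [MeasurableSpace Ω] (μ : Measure Ω)
    (A : Set Ω) (f : Ω → ℝ) :
    ∫ ω, f ω ∂(μ[|A]) = (μ.real A)⁻¹ * ∫ ω in A, f ω ∂μ := by
  rw [ProbabilityTheory.cond, integral_smul_measure, ENNReal.toReal_inv, smul_eq_mul,
    Measure.real]

/-- The set integral of an a.e. bounded real function is at most the bound times the measure. -/
theorem abs_setIntegral_le_of_ae_abs_le {Ω : Type*} [MeasurableSpace Ω] {μ : Measure Ω}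
    [IsFiniteMeasure μ] {f : Ω → ℝ} {C : ℝ} (hf : ∀ᵐ ω ∂μ, |f ω| ≤ C) (S : Set Ω) :
    |∫ ω in S, f ω ∂μ| ≤ C * μ.real S := by
  simp only [← Real.norm_eq_abs] at hf ⊢
  exact norm_setIntegral_le_of_norm_le_const_ae (measure_lt_top μ S) (ae_restrict_of_ae hf)

/-- Covariance bound: if `|X| ≤ C₁`, `|Y| ≤ C₂` a.s. and `X`, `Y` are uncorrelated
conditionally on an event `A`, then `|cov(X,Y)| ≤ 4 C₁ C₂ P(Aᶜ)`. -/
theorem covariance_bound_of_conditionally_uncorrelated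
    {Ω : Type*} [MeasurableSpace Ω] (μ : Measure Ω) [IsProbabilityMeasure μ]
    (X Y : Ω → ℝ) (hX : Measurable X) (hY : Measurable Y)
    (C₁ C₂ : ℝ) (hC₁ : ∀ᵐ ω ∂μ, |X ω| ≤ C₁) (hC₂ : ∀ᵐ ω ∂μ, |Y ω| ≤ C₂)
    (A : Set Ω) (hA : MeasurableSet A) (hApos : 0 < μ A)
    (huncorr : ∫ ω, X ω * Y ω ∂(μ[|A]) = (∫ ω, X ω ∂(μ[|A])) * ∫ ω, Y ω ∂(μ[|A])) :
    |(∫ ω, X ω * Y ω ∂μ) - (∫ ω, X ω ∂μ) * ∫ ω, Y ω ∂μ| ≤ 4 * C₁ * C₂ * (μ Aᶜ).toReal := by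
  have hXY : ∀ᵐ ω ∂μ, |X ω * Y ω| ≤ C₁ * C₂ := by
    filter_upwards [hC₁, hC₂] with ω h₁ h₂
    rw [abs_mul]
    exact mul_le_mul h₁ h₂ (abs_nonneg _) ((abs_nonneg _).trans h₁)
  obtain ⟨ω₀, hω₁, hω₂⟩ := (hC₁.and hC₂).exists
  have hC₁0 : 0 ≤ C₁ := (abs_nonneg _).trans hω₁
  have hC₂0 : 0 ≤ C₂ := (abs_nonneg _).trans hω₂
  have hp : 0 < μ.real A := ENNReal.toReal_pos hApos.ne' (measure_ne_top μ A)
  have hq : 0 ≤ μ.real Aᶜ := measureReal_nonneg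
  have hpq : μ.real A + μ.real Aᶜ = 1 := probReal_add_probReal_compl hA
  have hiX : Integrable X μ := .of_bound hX.aestronglyMeasurable C₁ hC₁
  have hiY : Integrable Y μ := .of_bound hY.aestronglyMeasurable C₂ hC₂
  have hiXY : Integrable (fun ω => X ω * Y ω) μ :=
    .of_bound (hX.mul hY).aestronglyMeasurable (C₁ * C₂) hXY
  simp only [integral_cond_eq_inv_mul_setIntegral] at huncorr
  rw [← integral_add_compl hA hiX, ← integral_add_compl hA hiY, ← integral_add_compl hA hiXY]
  change _ ≤ 4 * C₁ * C₂ * μ.real Aᶜ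
  have ha := abs_setIntegral_le_of_ae_abs_le hC₁ A
  have ha' := abs_setIntegral_le_of_ae_abs_le hC₁ Aᶜ
  have hb := abs_setIntegral_le_of_ae_abs_le hC₂ A
  have hb' := abs_setIntegral_le_of_ae_abs_le hC₂ Aᶜ
  have hc := abs_setIntegral_le_of_ae_abs_le hXY A
  have hc' := abs_setIntegral_le_of_ae_abs_le hXY Aᶜ
  generalize μ.real A = p at *
  generalize μ.real Aᶜ = q at *
  generalize (∫ ω in A, X ω ∂μ) = a at *
  generalize (∫ ω in Aᶜ, X ω ∂μ) = a' at *
  generalize (∫ ω in A, Y ω ∂μ) = b at *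
  generalize (∫ ω in Aᶜ, Y ω ∂μ) = b' at *
  generalize (∫ ω in A, X ω * Y ω ∂μ) = c at *
  generalize (∫ ω in Aᶜ, X ω * Y ω ∂μ) = c' at *
  have hab : p * c = a * b := by
    field_simp at huncorr
    linarith
  have hcov : c + c' - (a + a') * (b + b') = q * c + c' - a * b' - a' * b - a' * b' := by
    linear_combination hab - c * hpq
  have h₁ : |q * c| ≤ q * (C₁ * C₂ * p) := by
    rw [abs_mul, abs_of_nonneg hq]
    gcongr
  have h₂ : |a * b'| ≤ C₁ * p * (C₂ * q) := by
    rw [abs_mul]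
    gcongr
  have h₃ : |a' * b| ≤ C₁ * q * (C₂ * p) := by
    rw [abs_mul]
    gcongr
  have h₄ : |a' * b'| ≤ C₁ * q * (C₂ * q) := by
    rw [abs_mul]
    gcongr
  have hK : 0 ≤ C₁ * C₂ * q * q := by positivity
  obtain rfl : p = 1 - q := by linarith
  rw [hcov]
  rw [abs_le] at *
  constructor <;> linarith
end

section
/- Let $S_n$ be the number of simple chords in a uniformly random chord diagram of size $n \geq 2$. There exists a pair of random variables $(S_n, S_n^s)$ on a common probability space such that $S_n^s$ has the size-bias distribution of $S_n$ and $E|S_n + 1 - S_n^s| \leq \frac{10n}{(2n-1)^2}$. -/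
open MeasureTheory ProbabilityTheory Filter
open scoped Nat

/-- The fixed-point-free involutions of a finite type. -/
def fixedPointFreeInvolutions (α : Type*) [Fintype α] [DecidableEq α] :
    Finset (Equiv.Perm α) :=
  Finset.univ.filter fun π => (∀ i, π (π i) = i) ∧ ∀ i, π i ≠ i

/-- Conjugate `π` by a transposition so that `x` becomes matched with `y`. -/
def matchWith {α : Type*} [DecidableEq α] (x y : α) (π : Equiv.Perm α) : Equiv.Perm α :=
  MulAut.conj (Equiv.swap y (π x)) π

section FixedPointFreeInvolutions

variable {α : Type*} [Fintype α] [DecidableEq α]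

lemma mem_fixedPointFreeInvolutions {π : Equiv.Perm α} :
    π ∈ fixedPointFreeInvolutions α ↔ (∀ i, π (π i) = i) ∧ ∀ i, π i ≠ i := by
  simp [fixedPointFreeInvolutions]

lemma conj_mem_fixedPointFreeInvolutions_iff (τ π : Equiv.Perm α) :
    MulAut.conj τ π ∈ fixedPointFreeInvolutions α ↔ π ∈ fixedPointFreeInvolutions α := by
  simp only [mem_fixedPointFreeInvolutions, MulAut.conj_apply, Equiv.Perm.mul_apply]
  refine and_congr ?_ ?_
  · rw [← τ.forall_congr_right]
    simp
  · rw [← τ.forall_congr_right]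
    simp

lemma sum_conj_fixedPointFreeInvolutions {M : Type*} [AddCommMonoid M] (τ : Equiv.Perm α)
    (p q : Equiv.Perm α → Prop) [DecidablePred p] [DecidablePred q]
    (h : ∀ π, p π ↔ q (MulAut.conj τ π)) (f : Equiv.Perm α → M) :
    ∑ π ∈ fixedPointFreeInvolutions α with p π, f (MulAut.conj τ π) = ∑ π ∈ fixedPointFreeInvolutions α with q π, f π := by
  refine Finset.sum_equiv (MulAut.conj τ).toEquiv (fun π => ?_) (fun _ _ => rfl)
  simp only [Finset.mem_filter, h π]
  exact and_congr_left' (conj_mem_fixedPointFreeInvolutions_iff τ π).symm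

lemma sum_fiberwise_fixedPointFreeInvolutions {M : Type*} [AddCommMonoid M] (x : α)
    (f : Equiv.Perm α → M) :
    ∑ π ∈ fixedPointFreeInvolutions α, f π = ∑ a ∈ Finset.univ.erase x, ∑ π ∈ fixedPointFreeInvolutions α with π x = a, f π := by
  refine (Finset.sum_fiberwise_of_maps_to (fun π hπ => ?_) _).symm
  simpa using (mem_fixedPointFreeInvolutions.1 hπ).2 x

lemma sum_matchWith {x y : α} (hxy : y ≠ x) (f : Equiv.Perm α → ℝ) :
    ∑ π ∈ fixedPointFreeInvolutions α, f (matchWith x y π) =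
      ((Fintype.card α : ℝ) - 1) * ∑ π ∈ fixedPointFreeInvolutions α with π x = y, f π := by
  rw [sum_fiberwise_fixedPointFreeInvolutions x]
  have key : ∀ a ∈ Finset.univ.erase x,
      ∑ π ∈ fixedPointFreeInvolutions α with π x = a, f (matchWith x y π) = ∑ π ∈ fixedPointFreeInvolutions α with π x = y, f π := by
    intro a ha
    have hax : a ≠ x := by simpa using ha
    rw [← sum_conj_fixedPointFreeInvolutions (Equiv.swap y a) (fun π => π x = a)
      (fun π => π x = y)]
    · refine Finset.sum_congr rfl fun π hπ => ?_
      rw [matchWith, (Finset.mem_filter.1 hπ).2]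
    · intro π
      simp only [MulAut.conj_apply, Equiv.Perm.mul_apply, Equiv.swap_inv]
      rw [Equiv.swap_apply_of_ne_of_ne hxy.symm hax.symm, Equiv.swap_apply_eq_iff,
        Equiv.swap_apply_left]
  rw [Finset.sum_congr rfl key, Finset.sum_const, Finset.card_erase_of_mem (Finset.mem_univ x),
    nsmul_eq_mul, Finset.card_univ, Nat.cast_sub (Fintype.card_pos_iff.2 ⟨x⟩), Nat.cast_one]

lemma card_sub_one_mul_card_apply_eq {x y : α} (hxy : y ≠ x) :
    ((Fintype.card α : ℝ) - 1) * ((fixedPointFreeInvolutions α).filter fun π => π x = y).card = (fixedPointFreeInvolutions α).card := by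
  simpa using (sum_matchWith hxy fun _ => (1 : ℝ)).symm

lemma card_sub_three_mul_card_apply_eq_apply_eq {x y a b : α} (hxy : y ≠ x) (hax : a ≠ x)
    (hay : a ≠ y) (hbx : b ≠ x) (hby : b ≠ y) (hba : b ≠ a) :
    ((Fintype.card α : ℝ) - 3) * ((fixedPointFreeInvolutions α).filter fun π => π x = a ∧ π y = b).card ≤
      ((fixedPointFreeInvolutions α).filter fun π => π x = a).card := by
  have hcard : (({x, y, a} : Finset α)ᶜ.card : ℝ) = (Fintype.card α : ℝ) - 3 := by
    have h3 : ({x, y, a} : Finset α).card = 3 := Finset.card_eq_three.2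
      ⟨x, y, a, hxy.symm, hax.symm, hay.symm, rfl⟩
    rw [Finset.card_compl, Nat.cast_sub (Finset.card_le_univ _), h3]
    norm_num
  have key : ∀ c ∈ ({x, y, a} : Finset α)ᶜ,
      ((fixedPointFreeInvolutions α).filter fun π => π x = a ∧ π y = b).card =
        ((fixedPointFreeInvolutions α).filter fun π => π x = a ∧ π y = c).card := by
    intro c hc
    simp only [Finset.mem_compl, Finset.mem_insert, Finset.mem_singleton, not_or] at hc
    obtain ⟨hcx, hcy, hca⟩ := hc
    have h := sum_conj_fixedPointFreeInvolutions (Equiv.swap b c)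
      (fun π => π x = a ∧ π y = b) (fun π => π x = a ∧ π y = c) (fun π => by
        simp only [MulAut.conj_apply, Equiv.Perm.mul_apply, Equiv.swap_inv]
        rw [Equiv.swap_apply_of_ne_of_ne hbx.symm (Ne.symm hcx),
          Equiv.swap_apply_of_ne_of_ne hby.symm (Ne.symm hcy), Equiv.swap_apply_eq_iff,
          Equiv.swap_apply_eq_iff, Equiv.swap_apply_right,
          Equiv.swap_apply_of_ne_of_ne hba.symm (Ne.symm hca)]) (fun _ => 1)
    simpa using h
  have hsum : ∑ c ∈ ({x, y, a} : Finset α)ᶜ, ((fixedPointFreeInvolutions α).filter fun π => π x = a ∧ π y = c).card ≤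
      ((fixedPointFreeInvolutions α).filter fun π => π x = a).card := by
    simp only [← Finset.filter_filter]
    rw [Finset.sum_card_fiberwise_eq_card_filter]
    exact Finset.card_filter_le _ _
  rw [← hcard]
  rw [← Finset.sum_congr rfl key, Finset.sum_const, smul_eq_mul] at hsum
  exact_mod_cast hsum

lemma card_apply_eq_comp_apply_le {x y z : α} (hxy : y ≠ x) (hzx : z ≠ x) (hzy : z ≠ y)
    (g : α → α) (hg : ∀ a, g a ≠ a) (hz : g z = x ∨ g z = y) (hcard : 3 < Fintype.card α) :
    ((fixedPointFreeInvolutions α).filter fun π => π x ≠ y ∧ π y = g (π x)).card ≤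
      ((fixedPointFreeInvolutions α).filter fun π => π x = y).card := by
  have hm : (0 : ℝ) < (Fintype.card α : ℝ) - 3 := by
    rw [sub_pos]
    exact_mod_cast hcard
  set G : Finset α := {x, y, z}ᶜ with hG
  have hGcard : (G.card : ℝ) = (Fintype.card α : ℝ) - 3 := by
    have h3 : ({x, y, z} : Finset α).card = 3 := Finset.card_eq_three.2
      ⟨x, y, z, hxy.symm, hzx.symm, hzy.symm, rfl⟩
    rw [hG, Finset.card_compl, Nat.cast_sub (Finset.card_le_univ _), h3]
    norm_num
  have hfib : ((fixedPointFreeInvolutions α).filter fun π => π x ≠ y ∧ π y = g (π x)).card =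
      ∑ a ∈ G, ((fixedPointFreeInvolutions α).filter fun π => (π x ≠ y ∧ π y = g (π x)) ∧ π x = a).card := by
    simp only [← Finset.filter_filter (fun π : Equiv.Perm α => π x ≠ y ∧ π y = g (π x))]
    refine Finset.card_eq_sum_card_fiberwise fun π hπ => ?_
    simp only [Finset.coe_filter, Set.mem_ofPred_eq, mem_fixedPointFreeInvolutions] at hπ
    obtain ⟨⟨hinv, hfix⟩, hne, heq⟩ := hπ
    simp only [hG, Finset.coe_compl, Finset.coe_insert, Finset.coe_singleton, Set.mem_compl_iff,
      Set.mem_insert_iff, Set.mem_singleton_iff, not_or]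
    refine ⟨hfix x, hne, fun h => ?_⟩
    rw [h] at heq
    rcases hz with hz | hz
    · exact hne (by rw [← hinv y, heq, hz])
    · exact hfix y (heq.trans hz)
  have hterm : ∀ a ∈ G, ((Fintype.card α : ℝ) - 3) *
      ((fixedPointFreeInvolutions α).filter fun π => (π x ≠ y ∧ π y = g (π x)) ∧ π x = a).card ≤
        ((fixedPointFreeInvolutions α).filter fun π => π x = y).card := by
    intro a ha
    simp only [hG, Finset.mem_compl, Finset.mem_insert, Finset.mem_singleton, not_or] at ha
    obtain ⟨hax, hay, -⟩ := ha
    have hsame : (((fixedPointFreeInvolutions α).filter fun π => π x = a).card : ℝ) =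
        ((fixedPointFreeInvolutions α).filter fun π => π x = y).card := by
      have h1 := card_sub_one_mul_card_apply_eq hax
      have h2 := card_sub_one_mul_card_apply_eq hxy
      exact mul_left_cancel₀ (by linarith) (h1.trans h2.symm)
    rcases ((fixedPointFreeInvolutions α).filter fun π => (π x ≠ y ∧ π y = g (π x)) ∧ π x = a).eq_empty_or_nonempty
      with he | ⟨π, hπ⟩
    · rw [he]
      simp
    · simp only [Finset.mem_filter, mem_fixedPointFreeInvolutions] at hπ
      obtain ⟨⟨hinv, hfix⟩, ⟨hne, heq⟩, hxa⟩ := hπ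
      rw [hxa] at heq
      rw [← hsame]
      refine le_trans (mul_le_mul_of_nonneg_left ?_ hm.le)
        (card_sub_three_mul_card_apply_eq_apply_eq hxy hax hay (b := g a) ?_ ?_ (hg a))
      · refine Nat.cast_le.2 (Finset.card_le_card fun ρ hρ => ?_)
        simp only [Finset.mem_filter] at hρ ⊢
        obtain ⟨h1, ⟨-, h2⟩, h3⟩ := hρ
        exact ⟨h1, h3, by rw [h2, h3]⟩
      · rintro h
        exact hne (by rw [← hinv y, heq, h])
      · rw [← heq]
        exact hfix y
  have hall := Finset.sum_le_sum hterm
  rw [← Finset.mul_sum, Finset.sum_const, nsmul_eq_mul, hGcard] at hall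
  rw [← Nat.cast_le (α := ℝ), hfib, Nat.cast_sum]
  exact le_of_mul_le_mul_left hall hm

lemma card_apply_eq_add_card_matchWith {r : Equiv.Perm α} (hr : ∀ a, r (r a) ≠ a) (x : α)
    {π : Equiv.Perm α} (hπ : π ∈ fixedPointFreeInvolutions α) (hne : π x ≠ r x) :
    (Finset.univ.filter fun k => matchWith x (r x) π k = r k).card +
        (if π (r x) = r (r x) then 1 else 0) + (if r (π x) = x then 1 else 0) =
      (Finset.univ.filter fun k => π k = r k).card + 1 +
        (if π (r x) = r (π x) then 1 else 0) + (if π x = r (π (r x)) then 1 else 0) := by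
  obtain ⟨hinv, hfix⟩ := mem_fixedPointFreeInvolutions.1 hπ
  have hr1 : ∀ a, r a ≠ a := fun a h => hr a (by rw [h, h])
  set y := r x with hy
  set a := π x with ha
  set b := π y with hb
  have hax : a ≠ x := hfix x
  have hby : b ≠ y := hfix y
  have hyx : y ≠ x := hr1 x
  have hpa : π a = x := hinv x
  have hpb : π b = y := hinv y
  have hab : a ≠ b := fun h => hyx (π.injective h).symm
  have hbx : b ≠ x := fun h => hne (by rw [← hpb, h])
  set σ := matchWith x y π with hσ
  have hσk : ∀ k, σ k = Equiv.swap y a (π (Equiv.swap y a k)) := fun k => by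
    simp [hσ, matchWith, ha]
  have hσx : σ x = y := by
    rw [hσk, Equiv.swap_apply_of_ne_of_ne hyx.symm hax.symm, ← ha, Equiv.swap_apply_right]
  have hσy : σ y = x := by
    rw [hσk, Equiv.swap_apply_left, hpa, Equiv.swap_apply_of_ne_of_ne hyx.symm hax.symm]
  have hσa : σ a = b := by
    rw [hσk, Equiv.swap_apply_right, ← hb, Equiv.swap_apply_of_ne_of_ne hby hab.symm]
  have hσb : σ b = a := by
    rw [hσk, Equiv.swap_apply_of_ne_of_ne hby hab.symm, hpb, Equiv.swap_apply_left]
  have hσo : ∀ k ∈ ({x, y, a, b} : Finset α)ᶜ, σ k = π k := by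
    intro k hk
    simp only [Finset.mem_compl, Finset.mem_insert, Finset.mem_singleton, not_or] at hk
    obtain ⟨h1, h2, h3, h4⟩ := hk
    rw [hσk, Equiv.swap_apply_of_ne_of_ne h2 h3, Equiv.swap_apply_of_ne_of_ne]
    · exact fun h => h4 (by rw [hb, ← h, hinv])
    · exact fun h => h1 (π.injective h)
  have hsplit : ∀ ρ : Equiv.Perm α, (Finset.univ.filter fun k => ρ k = r k).card =
      (if ρ x = r x then 1 else 0) + ((if ρ y = r y then 1 else 0) +
        ((if ρ a = r a then 1 else 0) + (if ρ b = r b then 1 else 0))) +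
        ∑ k ∈ ({x, y, a, b} : Finset α)ᶜ, if ρ k = r k then 1 else 0 := by
    intro ρ
    rw [Finset.card_filter, ← Finset.sum_add_sum_compl ({x, y, a, b} : Finset α),
      Finset.sum_insert (by simp [hyx.symm, hax.symm, hbx.symm]),
      Finset.sum_insert (by simp [hne.symm, hby.symm]),
      Finset.sum_insert (by simp [hab]), Finset.sum_singleton]
  rw [hsplit σ, hsplit π, Finset.sum_congr rfl fun k hk => by rw [hσo k hk],
    hσx, hσy, hσa, hσb, hpa, hpb, ← ha, ← hb, ← hy,
    if_pos rfl, if_neg (hr x).symm, if_neg hne, if_neg (fun h => hbx (r.injective h).symm)]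
  simp only [eq_comm (a := r a) (b := x)]
  omega

lemma abs_card_add_one_sub_card_matchWith_le {r : Equiv.Perm α} (hr : ∀ a, r (r a) ≠ a) (x : α)
    {π : Equiv.Perm α} (hπ : π ∈ fixedPointFreeInvolutions α) :
    |((Finset.univ.filter fun k => π k = r k).card : ℝ) + 1 -
        (Finset.univ.filter fun k => matchWith x (r x) π k = r k).card| ≤
      (if π x = r x then 1 else 0) + (if π (r x) = r (r x) then 1 else 0) +
        (if π x = r.symm x then 1 else 0) +
        (if π x ≠ r x ∧ π (r x) = r (π x) then 1 else 0) +
        (if π x ≠ r x ∧ π (r x) = r.symm (π x) then 1 else 0) := by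
  by_cases hne : π x = r x
  · have : matchWith x (r x) π = π := by
      rw [matchWith, hne, Equiv.swap_self, ← Equiv.Perm.one_def, map_one, MulAut.one_apply]
    rw [this, if_pos hne]
    simp only [hne, ne_eq, not_true_eq_false, false_and, if_false, add_sub_cancel_left, abs_one]
    split_ifs <;> norm_num
  · have h := congrArg (Nat.cast : ℕ → ℝ) (card_apply_eq_add_card_matchWith hr x hπ hne)
    push_cast at h
    simp only [Equiv.eq_symm_apply, ne_eq, hne, not_false_eq_true, true_and]
    simp only [eq_comm (a := π x) (b := r (π (r x)))] at h
    rw [abs_le]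
    constructor <;> split_ifs at h ⊢ <;> linarith

lemma sum_abs_card_add_one_sub_card_matchWith_le {r : Equiv.Perm α} (hr : ∀ a, r (r a) ≠ a)
    (hcard : 3 < Fintype.card α) (x : α) :
    ∑ π ∈ fixedPointFreeInvolutions α, |((Finset.univ.filter fun k => π k = r k).card : ℝ) + 1 -
        (Finset.univ.filter fun k => matchWith x (r x) π k = r k).card| ≤
      5 * ((fixedPointFreeInvolutions α).card / ((Fintype.card α : ℝ) - 1)) := by
  have hr1 : ∀ a, r a ≠ a := fun a h => hr a (by rw [h, h])
  have hs1 : ∀ a, r.symm a ≠ a := fun a h => hr1 a (by rw [← Equiv.eq_symm_apply, h])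
  have hm : (0 : ℝ) < (Fintype.card α : ℝ) - 1 := by
    rw [sub_pos]
    exact_mod_cast (by omega : 1 < Fintype.card α)
  have hA : ∀ {u v : α}, v ≠ u → (((fixedPointFreeInvolutions α).filter fun π => π u = v).card : ℝ) =
      (fixedPointFreeInvolutions α).card / ((Fintype.card α : ℝ) - 1) := fun huv => by
    rw [eq_div_iff hm.ne', mul_comm, card_sub_one_mul_card_apply_eq huv]
  refine (Finset.sum_le_sum fun π hπ => abs_card_add_one_sub_card_matchWith_le hr x hπ).trans ?_
  simp only [Finset.sum_add_distrib, Finset.sum_boole]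
  have h1 := hA (hr1 x)
  have h2 := hA (hr1 (r x))
  have h3 := hA (hs1 x)
  have h4 : (((fixedPointFreeInvolutions α).filter fun π => π x ≠ r x ∧ π (r x) = r (π x)).card : ℝ) ≤
      ((fixedPointFreeInvolutions α).filter fun π => π x = r x).card := by
    refine Nat.cast_le.2 (card_apply_eq_comp_apply_le (hr1 x) (hs1 x) (fun h => ?_) r hr1
      (Or.inl (r.apply_symm_apply x)) hcard)
    exact hr x (by rw [← h, r.apply_symm_apply])
  have h5 : (((fixedPointFreeInvolutions α).filter fun π => π x ≠ r x ∧ π (r x) = r.symm (π x)).card : ℝ) ≤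
      ((fixedPointFreeInvolutions α).filter fun π => π x = r x).card :=
    Nat.cast_le.2 (card_apply_eq_comp_apply_le (hr1 x) (hr x) (hr1 (r x)) r.symm hs1
      (Or.inr (r.symm_apply_apply (r x))) hcard)
  linarith

/-- Averaging `matchWith` over all `x` reweights a diagram by its number of `r`-chords. -/
lemma sum_sum_matchWith {r : Equiv.Perm α} (hr : ∀ a, r a ≠ a) (f : Equiv.Perm α → ℝ) :
    ∑ x, ∑ π ∈ fixedPointFreeInvolutions α, f (matchWith x (r x) π) =
      ((Fintype.card α : ℝ) - 1) *
        ∑ π ∈ fixedPointFreeInvolutions α, (Finset.univ.filter fun k => π k = r k).card * f π := by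
  simp only [sum_matchWith (hr _), ← Finset.mul_sum, Finset.sum_filter]
  rw [Finset.sum_comm]
  simp only [← Finset.sum_filter, Finset.sum_const, nsmul_eq_mul]

end FixedPointFreeInvolutions

lemma integral_uniformOn_finset {Ω : Type*} [MeasurableSpace Ω] [Fintype Ω]
    [MeasurableSingletonClass Ω] (s : Finset Ω) (f : Ω → ℝ) :
    ∫ ω, f ω ∂uniformOn (s : Set Ω) = (∑ ω ∈ s, f ω) / s.card := by
  classical
  have hreal : ∀ ω, (uniformOn (s : Set Ω)).real {ω} = if ω ∈ s then (s.card : ℝ)⁻¹ else 0 := by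
    intro ω
    rw [Measure.real, ← Finset.coe_singleton, uniformOn_apply_finset]
    by_cases h : ω ∈ s <;> simp [h]
  rw [integral_fintype .of_finite]
  simp only [hreal, smul_eq_mul, ite_mul, zero_mul, Finset.sum_ite_mem, Finset.univ_inter,
    ← Finset.mul_sum]
  rw [div_eq_inv_mul]

lemma uniformCD_eq (n : ℕ) :
    uniformCD n = uniformOn (fixedPointFreeInvolutions (Fin (2 * n)) : Set _) := by
  rw [uniformCD]
  congr 1
  ext π
  exact mem_fixedPointFreeInvolutions.symm

lemma fixedPointFreeInvolutions_fin_nonempty (n : ℕ) :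
    (fixedPointFreeInvolutions (Fin (2 * n))).Nonempty := by
  refine ⟨Fin.revPerm, mem_fixedPointFreeInvolutions.2 ⟨fun i => by simp, fun i h => ?_⟩⟩
  have := congrArg Fin.val h
  simp only [Fin.revPerm_apply, Fin.val_rev] at this
  omega

lemma finRotate_finRotate_ne {N : ℕ} (hN : 3 ≤ N) (i : Fin N) :
    finRotate N (finRotate N i) ≠ i := by
  obtain ⟨m, rfl⟩ : ∃ m, N = m + 1 := ⟨N - 1, by omega⟩
  intro h
  have h1 := congrArg Fin.val h
  rw [coe_finRotate, coe_finRotate] at h1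
  simp only [Fin.ext_iff, coe_finRotate, Fin.val_last] at h1
  split_ifs at h1 <;> omega

/-- There is a size-bias coupling `(Sₙ, Sₙˢ)` for the number of simple chords with
`E|Sₙ + 1 - Sₙˢ| ≤ 10n/(2n-1)²`. -/
theorem simpleChords_size_bias_coupling (n : ℕ) (hn : 2 ≤ n) :
    ∃ (Ω : Type) (_ : MeasurableSpace Ω) (μ : Measure Ω) (S Ss : Ω → ℕ),
      IsProbabilityMeasure μ ∧ Measurable S ∧ Measurable Ss ∧
      μ.map S = (uniformCD n).map (fun π => simpleChords π) ∧
      (∀ k : ℕ, (μ {ω | Ss ω = k}).toReal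
          = (k : ℝ) * (μ {ω | S ω = k}).toReal / (∫ ω, (S ω : ℝ) ∂μ)) ∧
      (∫ ω, |(S ω : ℝ) + 1 - (Ss ω : ℝ)| ∂μ) ≤ 10 * n / (2 * (n : ℝ) - 1) ^ 2 := by
  set F := fixedPointFreeInvolutions (Fin (2 * n))
  set r := finRotate (2 * n)
  have hr : ∀ a, r (r a) ≠ a := finRotate_finRotate_ne (by omega)
  have hr1 : ∀ a, r a ≠ a := fun a h => hr a (by rw [h, h])
  have : NeZero (2 * n) := ⟨by omega⟩
  have hn' : (2 : ℝ) ≤ n := by exact_mod_cast hn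
  have hN : (0 : ℝ) < F.card := by
    exact_mod_cast (fixedPointFreeInvolutions_fin_nonempty n).card_pos
  have hcard : (Fintype.card (Fin (2 * n)) : ℝ) = 2 * n := by simp
  have hprob : IsProbabilityMeasure (uniformCD n) := by
    rw [uniformCD_eq]
    exact isProbabilityMeasure_uniformOn (Finset.finite_toSet _)
      (fixedPointFreeInvolutions_fin_nonempty n)
  let ρ : Measure (Fin (2 * n)) := uniformOn Set.univ
  let μ := (uniformCD n).prod ρ
  have hint : ∀ f : Equiv.Perm (Fin (2 * n)) × Fin (2 * n) → ℝ,
      ∫ ω, f ω ∂μ = (∑ x, ∑ π ∈ F, f (π, x)) / (2 * n) / F.card := by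
    intro f
    rw [integral_prod _ .of_finite, uniformCD_eq, integral_uniformOn_finset, Finset.sum_comm]
    congr 1
    rw [Finset.sum_div]
    refine Finset.sum_congr rfl fun π _ => ?_
    simp only [ρ, ← Finset.coe_univ]
    rw [integral_uniformOn_finset, Finset.card_univ, hcard]
  have hmeas : ∀ (T : Equiv.Perm (Fin (2 * n)) × Fin (2 * n) → ℕ) (k : ℕ),
      (μ {ω | T ω = k}).toReal = (∑ x, ∑ π ∈ F, if T (π, x) = k then 1 else 0) /
        (2 * n) / F.card := by
    intro T k
    rw [← hint fun ω => if T ω = k then 1 else 0, ← Measure.real,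
      ← integral_indicator_one (Set.toFinite _).measurableSet]
    simp [Set.indicator_apply]
  have hmean : ∑ π ∈ F, (simpleChords π : ℝ) = 2 * n * F.card / (2 * n - 1) := by
    have h := sum_sum_matchWith hr1 fun _ => (1 : ℝ)
    simp only [Finset.sum_const, Finset.card_univ, mul_one, nsmul_eq_mul, hcard] at h
    rw [eq_div_iff (by linarith), h, mul_comm]
    rfl
  refine ⟨Equiv.Perm (Fin (2 * n)) × Fin (2 * n), inferInstance, μ,
    fun ω => simpleChords ω.1, fun ω => simpleChords (matchWith ω.2 (r ω.2) ω.1),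
    inferInstance, .of_discrete, .of_discrete, ?_, fun k => ?_, ?_⟩
  · change μ.map (simpleChords ∘ Prod.fst) = _
    rw [← Measure.map_map .of_discrete measurable_fst, Measure.map_fst_prod, measure_univ,
      one_smul]
  · have h := sum_sum_matchWith hr1 fun π => if simpleChords π = k then (1 : ℝ) else 0
    have hk : ∀ π ∈ F, ((Finset.univ.filter fun i => π i = r i).card : ℝ) *
        (if simpleChords π = k then 1 else 0) = k * if simpleChords π = k then 1 else 0 := by
      intro π _
      split_ifs with hπ
      · rw [← hπ]
        rfl
      · simp
    rw [Finset.sum_congr rfl hk, ← Finset.mul_sum, hcard] at h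
    have hS : (μ {ω | simpleChords ω.1 = k}).toReal =
        (2 * n * ∑ π ∈ F, if simpleChords π = k then 1 else 0) / (2 * n) / F.card := by
      rw [hmeas]
      congr 2
      refine (Finset.sum_const (∑ π ∈ F, if simpleChords π = k then (1 : ℝ) else 0)).trans ?_
      rw [nsmul_eq_mul, Finset.card_univ, hcard]
    rw [hmeas, hS, hint, h]
    simp only [Finset.sum_const, Finset.card_univ, nsmul_eq_mul, hcard, hmean]
    have : (2 : ℝ) * n - 1 ≠ 0 := by linarith
    field_simp
  · rw [hint]
    have hbound := Finset.sum_le_sum fun x (_ : x ∈ Finset.univ) =>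
      sum_abs_card_add_one_sub_card_matchWith_le hr (by simp; omega) x
    rw [Finset.sum_const, Finset.card_univ, nsmul_eq_mul, hcard] at hbound
    have hpos : (0 : ℝ) < 2 * n - 1 := by linarith
    calc _ ≤ 2 * n * (5 * (F.card / (2 * n - 1 : ℝ))) / (2 * n) / F.card := by
          gcongr
          exact hbound
      _ = 5 / (2 * n - 1 : ℝ) := by field_simp
      _ ≤ _ := by
          rw [div_le_div_iff₀ hpos (by positivity)]
          nlinarith
end

section
/- Let $s(n)$ be the number of chord diagrams of size $n$ with no simple chords. Then $\lim_{n \to \infty} \frac{s(n)}{(2n-1)!!} = \frac{1}{e}$; that is, $s(n) = \frac{(2n-1)!!}{e}(1 + o(1))$, so the probability that a uniformly random chord diagram of size $n$ contains no simple chords tends to $1/e$. -/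
open MeasureTheory ProbabilityTheory Filter
open scoped Nat

open scoped Classical in
/-- The number of chord diagrams of size `n` with no simple chords. -/
noncomputable def simpleChordFree (n : ℕ) : ℕ :=
  ((Finset.univ : Finset (Equiv.Perm (Fin (2 * n)))).filter
    (fun π => IsChordDiagram π ∧ simpleChords π = 0)).card

/-- A partial fixed-point-free involution, defined on `D` and with `2 * r` points outside `D`, has
`(2 * r - 1)‼` extensions to a fixed-point-free involution of the whole type. -/
lemma card_involutions_extending {α : Type*} [Fintype α] [DecidableEq α] (r : ℕ) :
    ∀ (D : Finset α) (σ : α → α), (∀ x ∈ D, σ x ∈ D ∧ σ (σ x) = x ∧ σ x ≠ x) →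
      Dᶜ.card = 2 * r →
      (Finset.univ.filter fun π : Equiv.Perm α =>
        ((∀ i, π (π i) = i) ∧ ∀ i, π i ≠ i) ∧ ∀ x ∈ D, π x = σ x).card = (2 * r - 1)‼ := by
  induction r with
  | zero =>
    intro D σ hσ hD
    have hD' : ∀ x, x ∈ D := by simpa [Finset.eq_univ_iff_forall] using hD
    have hinv : Function.Involutive σ := fun x => (hσ x (hD' x)).2.1
    have : (Finset.univ.filter fun π : Equiv.Perm α =>
        ((∀ i, π (π i) = i) ∧ ∀ i, π i ≠ i) ∧ ∀ x ∈ D, π x = σ x) = {hinv.toPerm σ} := by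
      ext π
      simp only [Finset.mem_filter, Finset.mem_univ, true_and, Finset.mem_singleton]
      constructor
      · rintro ⟨-, h⟩
        ext x
        exact h x (hD' x)
      · rintro rfl
        exact ⟨⟨fun i => hinv i, fun i => (hσ i (hD' i)).2.2⟩, fun x _ => rfl⟩
    rw [this]
    simp
  | succ r ih =>
    intro D σ hσ hD
    obtain ⟨x, hx⟩ : (Dᶜ).Nonempty := by
      rw [← Finset.card_pos]
      omega
    have hxD : x ∉ D := by simpa using hx
    rw [Finset.card_eq_sum_card_fiberwise (f := fun π : Equiv.Perm α => π x)
      (t := Dᶜ.erase x)]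
    · rw [Finset.sum_congr rfl (g := fun _ => (2 * r - 1)‼)]
      · rw [Finset.sum_const, Finset.card_erase_of_mem hx, hD, smul_eq_mul]
        cases r with
        | zero => simp
        | succ r => exact (Nat.doubleFactorial_add_two (2 * r + 1)).symm
      · intro y hy
        obtain ⟨hyx, hyD⟩ : y ≠ x ∧ y ∉ D := by simpa using hy
        rw [← ih (insert x (insert y D)) (Function.update (Function.update σ x y) y x)]
        · congr 1
          ext π
          simp only [Finset.mem_filter, Finset.mem_univ, true_and, Finset.mem_insert]
          constructor
          · rintro ⟨⟨⟨h1, h2⟩, h3⟩, h4⟩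
            refine ⟨⟨h1, h2⟩, ?_⟩
            rintro z (rfl | rfl | hz)
            · simp [hyx.symm, h4]
            · simp [← h4, h1]
            · have hzx : z ≠ x := fun h => hxD (h ▸ hz)
              have hzy : z ≠ y := fun h => hyD (h ▸ hz)
              simp [hzx, hzy, h3 z hz]
          · rintro ⟨h12, h3⟩
            refine ⟨⟨h12, fun z hz => ?_⟩, ?_⟩
            · have hzx : z ≠ x := fun h => hxD (h ▸ hz)
              have hzy : z ≠ y := fun h => hyD (h ▸ hz)
              simpa [Function.update_apply, hzx, hzy] using h3 z (Or.inr (Or.inr hz))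
            · simpa [Function.update_apply, hyx.symm] using h3 x (Or.inl rfl)
        · intro z hz
          simp only [Finset.mem_insert] at hz
          rcases hz with rfl | rfl | hz
          · simp [hyx, hyx.symm]
          · simp [hyx.symm]
          · have hzx : z ≠ x := fun h => hxD (h ▸ hz)
            have hzy : z ≠ y := fun h => hyD (h ▸ hz)
            obtain ⟨h1, h2, h3⟩ := hσ z hz
            have hzx' : σ z ≠ x := fun h => hxD (h ▸ h1)
            have hzy' : σ z ≠ y := fun h => hyD (h ▸ h1)
            simp [hzx, hzy, hzx', hzy', h1, h2, h3]
        · have h := Finset.card_add_card_compl D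
          have h' := Finset.card_add_card_compl (insert x (insert y D))
          rw [Finset.card_insert_of_notMem (by simp [hxD, hyx.symm]),
            Finset.card_insert_of_notMem hyD] at h'
          omega
    · intro π hπ
      simp only [Finset.coe_filter, Finset.mem_univ, true_and, Set.mem_ofPred_eq] at hπ
      obtain ⟨⟨h1, h2⟩, h3⟩ := hπ
      simp only [Finset.coe_erase, Finset.coe_compl, Set.mem_sdiff, Set.mem_compl_iff,
        Finset.mem_coe, Set.mem_singleton_iff]
      refine ⟨fun h => hxD ?_, h2 x⟩
      have h4 := h3 _ h
      rw [h1] at h4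
      rw [h4]
      exact (hσ _ h).1

lemma disjoint_map_of_independent {α : Type*} {ρ : Equiv.Perm α} {S : Finset α}
    (hS : ∀ k ∈ S, ρ k ∉ S) :
    Disjoint S (S.map ρ.toEmbedding) := by
  rw [Finset.disjoint_left]
  intro x hx hx'
  obtain ⟨y, hy, rfl⟩ := Finset.mem_map.1 hx'
  exact hS y hy hx

section IndependentSets

variable {α : Type*} [Fintype α] [DecidableEq α]

/-- The sets of `j` points containing no two points adjacent under the permutation `ρ`. -/
def independentSets (ρ : Equiv.Perm α) (j : ℕ) : Finset (Finset α) :=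
  Finset.univ.filter fun S => S.card = j ∧ ∀ k ∈ S, ρ k ∉ S

lemma mem_independentSets {ρ : Equiv.Perm α} {j : ℕ} {S : Finset α} :
    S ∈ independentSets ρ j ↔ S.card = j ∧ ∀ k ∈ S, ρ k ∉ S := by
  simp [independentSets]

/-- The fixed-point-free involutions that agree with `ρ` on an independent set. -/
lemma card_involutions_of_independent {ρ : Equiv.Perm α} {n : ℕ}
    (hn : Fintype.card α = 2 * n) (hρ : ∀ k, ρ k ≠ k) {S : Finset α} (hS : ∀ k ∈ S, ρ k ∉ S) :
    (Finset.univ.filter fun π : Equiv.Perm α =>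
      ((∀ i, π (π i) = i) ∧ ∀ i, π i ≠ i) ∧ ∀ x ∈ S, π x = ρ x).card =
      (2 * (n - S.card) - 1)‼ := by
  have hdisj := disjoint_map_of_independent hS
  rw [← card_involutions_extending (n - S.card) (S ∪ S.map ρ.toEmbedding)
    (fun x => if x ∈ S then ρ x else ρ.symm x)]
  · congr 1
    ext π
    simp only [Finset.mem_filter, Finset.mem_univ, true_and, and_congr_right_iff]
    rintro ⟨h1, h2⟩
    constructor
    · intro h x hx
      rcases Finset.mem_union.1 hx with hx | hx
      · simp [hx, h x hx]
      · obtain ⟨y, hy, rfl⟩ := Finset.mem_map.1 hx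
        simp only [Equiv.coe_toEmbedding, hS y hy, if_false, Equiv.symm_apply_apply]
        rw [← h y hy, h1]
    · intro h x hx
      simpa [hx] using h x (Finset.mem_union_left _ hx)
  · intro x hx
    rcases Finset.mem_union.1 hx with hx | hx
    · simp [hx, hS x hx, hρ x]
    · obtain ⟨y, hy, rfl⟩ := Finset.mem_map.1 hx
      simp [hy, hS y hy, (hρ y).symm]
  · rw [Finset.card_compl, Finset.card_union_of_disjoint hdisj, Finset.card_map, hn]
    omega

lemma succ_mul_card_independentSets (ρ : Equiv.Perm α) (hρ : ∀ k, ρ k ≠ k) (j : ℕ) :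
    (j + 1) * (independentSets ρ (j + 1)).card = ∑ S ∈ independentSets ρ j,
      (S ∪ S.map ρ.toEmbedding ∪ S.map ρ.symm.toEmbedding)ᶜ.card := by
  have h : (j + 1) * (independentSets ρ (j + 1)).card =
      ∑ T ∈ independentSets ρ (j + 1), T.card := by
    rw [Finset.sum_congr rfl fun T hT => (mem_independentSets.1 hT).1, Finset.sum_const,
      smul_eq_mul, mul_comm]
  rw [h, ← Finset.card_sigma, ← Finset.card_sigma]
  refine Finset.card_bij' (fun p _ => ⟨p.1.erase p.2, p.2⟩) (fun p _ => ⟨insert p.2 p.1, p.2⟩)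
    ?_ ?_ ?_ ?_
  · rintro ⟨T, k⟩ hT
    simp only [Finset.mem_sigma, mem_independentSets] at hT
    obtain ⟨⟨h1, h2⟩, h3⟩ := hT
    simp only [Finset.mem_sigma, mem_independentSets, Finset.card_erase_of_mem h3, h1,
      Finset.mem_erase, Finset.mem_compl, Finset.mem_union, Finset.mem_map_equiv]
    refine ⟨⟨rfl, fun x hx hx' => h2 x hx.2 hx'.2⟩, ?_⟩
    rintro ((hk | hk) | hk)
    · exact hk.1 rfl
    · exact h2 _ hk.2 (by simpa using h3)
    · exact h2 _ h3 hk.2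
  · rintro ⟨S, k⟩ hS
    simp only [Finset.mem_sigma, mem_independentSets, Finset.mem_compl, Finset.mem_union,
      Finset.mem_map_equiv, not_or, Equiv.symm_symm] at hS
    obtain ⟨⟨h1, h2⟩, ⟨h3, h4⟩, h5⟩ := hS
    simp only [Finset.mem_sigma, mem_independentSets, Finset.card_insert_of_notMem h3, h1,
      Finset.mem_insert, true_and, true_or, and_true]
    rintro x (rfl | hx) (hx' | hx')
    · exact hρ _ hx'
    · exact h5 hx'
    · exact h4 (by simpa [← hx'] using hx)
    · exact h2 x hx hx'
  · rintro ⟨T, k⟩ hT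
    have hk : k ∈ T := (Finset.mem_sigma.1 hT).2
    simp [Finset.insert_erase hk]
  · rintro ⟨S, k⟩ hS
    have hk : k ∉ S := fun h => by simp [h] at hS
    simp [Finset.erase_insert hk]

lemma succ_mul_card_independentSets_le (ρ : Equiv.Perm α) (hρ : ∀ k, ρ k ≠ k) (j : ℕ) :
    (j + 1) * (independentSets ρ (j + 1)).card ≤
      (independentSets ρ j).card * (Fintype.card α - 2 * j) := by
  rw [succ_mul_card_independentSets ρ hρ, ← smul_eq_mul, ← Finset.sum_const]
  refine Finset.sum_le_sum fun S hS => ?_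
  obtain ⟨h1, h2⟩ := mem_independentSets.1 hS
  have h3 : (S ∪ S.map ρ.toEmbedding).card = 2 * j := by
    rw [Finset.card_union_of_disjoint (disjoint_map_of_independent h2), Finset.card_map, h1]
    omega
  have h4 := Finset.card_le_card (Finset.subset_union_left
    (s₁ := S ∪ S.map ρ.toEmbedding) (s₂ := S.map ρ.symm.toEmbedding))
  rw [Finset.card_compl]
  omega

lemma le_succ_mul_card_independentSets (ρ : Equiv.Perm α) (hρ : ∀ k, ρ k ≠ k) (j : ℕ) :
    (independentSets ρ j).card * (Fintype.card α - 3 * j) ≤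
      (j + 1) * (independentSets ρ (j + 1)).card := by
  rw [succ_mul_card_independentSets ρ hρ, ← smul_eq_mul, ← Finset.sum_const]
  refine Finset.sum_le_sum fun S hS => ?_
  obtain ⟨h1, h2⟩ := mem_independentSets.1 hS
  have h3 := Finset.card_union_le (S ∪ S.map ρ.toEmbedding) (S.map ρ.symm.toEmbedding)
  have h4 := Finset.card_union_le S (S.map ρ.toEmbedding)
  rw [Finset.card_map] at h3 h4
  rw [Finset.card_compl]
  omega

/-- Inclusion–exclusion for the fixed-point-free involutions that agree with `ρ` nowhere. -/
lemma card_involutions_avoiding {ρ : Equiv.Perm α} {n : ℕ} (hn : Fintype.card α = 2 * n)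
    (hρ : ∀ k, ρ k ≠ k) (hρ' : ∀ k, ρ (ρ k) ≠ k) :
    ((Finset.univ.filter fun π : Equiv.Perm α =>
      ((∀ i, π (π i) = i) ∧ ∀ i, π i ≠ i) ∧ ∀ k, π k ≠ ρ k).card : ℤ) =
      ∑ j ∈ Finset.range (2 * n + 1),
        (-1) ^ j * ((independentSets ρ j).card * (2 * (n - j) - 1)‼ : ℤ) := by
  set C := Finset.univ.filter fun π : Equiv.Perm α => (∀ i, π (π i) = i) ∧ ∀ i, π i ≠ i with hC
  have hfilter : (Finset.univ.filter fun π : Equiv.Perm α =>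
      ((∀ i, π (π i) = i) ∧ ∀ i, π i ≠ i) ∧ ∀ k, π k ≠ ρ k) =
      C.filter fun π => (Finset.univ.filter fun k => π k = ρ k) = ∅ := by
    ext π
    simp [hC, Finset.filter_eq_empty_iff]
  have hcount (S : Finset α) : ((C.filter fun π => ∀ k ∈ S, π k = ρ k).card : ℤ) =
      if ∀ k ∈ S, ρ k ∉ S then ((2 * (n - S.card) - 1)‼ : ℤ) else 0 := by
    split_ifs with hS
    · rw [hC, Finset.filter_filter, card_involutions_of_independent hn hρ hS]
    · push Not at hS
      obtain ⟨k, hk, hk'⟩ := hS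
      rw [Nat.cast_eq_zero, Finset.card_eq_zero, Finset.filter_eq_empty_iff]
      intro π hπ h
      simp only [hC, Finset.mem_filter, Finset.mem_univ, true_and] at hπ
      apply hρ' k
      rw [← h _ hk', ← h _ hk, hπ.1]
  calc _ = ∑ π ∈ C, ∑ S ∈ (Finset.univ.filter fun k => π k = ρ k).powerset,
          (-1 : ℤ) ^ S.card := by
        rw [hfilter, Finset.card_filter]
        push_cast
        exact Finset.sum_congr rfl fun π _ => Finset.sum_powerset_neg_one_pow_card.symm
    _ = ∑ π ∈ C, ∑ S : Finset α, if ∀ k ∈ S, π k = ρ k then (-1 : ℤ) ^ S.card else 0 := by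
        refine Finset.sum_congr rfl fun π _ => ?_
        rw [← Finset.sum_filter]
        refine Finset.sum_congr ?_ fun _ _ => rfl
        ext S
        simp [Finset.subset_iff]
    _ = ∑ S : Finset α, if ∀ k ∈ S, ρ k ∉ S then
          (-1 : ℤ) ^ S.card * ((2 * (n - S.card) - 1)‼ : ℤ) else 0 := by
        rw [Finset.sum_comm]
        refine Finset.sum_congr rfl fun S _ => ?_
        rw [← Finset.sum_filter, Finset.sum_const, nsmul_eq_mul, hcount]
        split_ifs <;> ring
    _ = ∑ j ∈ Finset.range (2 * n + 1), ∑ S ∈ Finset.univ.filter fun S : Finset α => S.card = j,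
          if ∀ k ∈ S, ρ k ∉ S then
            (-1 : ℤ) ^ S.card * ((2 * (n - S.card) - 1)‼ : ℤ) else 0 := by
        refine (Finset.sum_fiberwise_of_maps_to (fun S _ => ?_) _).symm
        have := Finset.card_le_univ S
        rw [Finset.mem_range]
        omega
    _ = _ := by
        refine Finset.sum_congr rfl fun j _ => ?_
        rw [← Finset.sum_filter, Finset.filter_filter, ← independentSets,
          Finset.sum_congr rfl (g := fun _ => (-1 : ℤ) ^ j * ((2 * (n - j) - 1)‼ : ℤ)),
          Finset.sum_const, nsmul_eq_mul]
        · ring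
        · intro S hS
          rw [(mem_independentSets.1 hS).1]

lemma card_independentSets_zero (ρ : Equiv.Perm α) : (independentSets ρ 0).card = 1 := by
  have : independentSets ρ 0 = {∅} := by
    ext S
    simp only [mem_independentSets, Finset.card_eq_zero, Finset.mem_singleton,
      and_iff_left_iff_imp]
    rintro rfl
    simp
  simp [this]

end IndependentSets

lemma finRotate_ne_self {N : ℕ} (hN : 2 ≤ N) (k : Fin N) : finRotate N k ≠ k := by
  obtain ⟨N, rfl⟩ := Nat.exists_eq_add_of_le' hN
  rw [finRotate_apply]
  simp

lemma finRotate_finRotate_ne_self {N : ℕ} (hN : 3 ≤ N) (k : Fin N) :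
    finRotate N (finRotate N k) ≠ k := by
  obtain ⟨N, rfl⟩ := Nat.exists_eq_add_of_le' hN
  rw [finRotate_apply, finRotate_apply, add_assoc, Ne, add_eq_left, Fin.ext_iff]
  simp [Fin.val_add, Nat.mod_eq_of_lt (show 2 < N + 2 + 1 by omega)]

/-- The expected number of `j`-sets of simple chords in a random chord diagram of size `n`. -/
noncomputable def simpleChordMoment (n j : ℕ) : ℝ :=
  (independentSets (finRotate (2 * n)) j).card * (2 * (n - j) - 1)‼ / (2 * n - 1)‼

lemma simpleChordMoment_nonneg (n j : ℕ) : 0 ≤ simpleChordMoment n j := by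
  unfold simpleChordMoment
  positivity

lemma simpleChordMoment_zero (n : ℕ) : simpleChordMoment n 0 = 1 := by
  have : ((2 * n - 1)‼ : ℝ) ≠ 0 := by exact_mod_cast (Nat.doubleFactorial_pos _).ne'
  simp [simpleChordMoment, card_independentSets_zero, this]

lemma simpleChordFree_ratio_eq {n : ℕ} (hn : 2 ≤ n) :
    (simpleChordFree n : ℝ) / ((2 * n - 1)‼ : ℝ) =
      ∑' j, (-1 : ℝ) ^ j * simpleChordMoment n j := by
  have h := card_involutions_avoiding (ρ := finRotate (2 * n)) (n := n) (by simp)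
    (finRotate_ne_self (by omega)) (finRotate_finRotate_ne_self (by omega))
  have h' : (simpleChordFree n : ℤ) = ∑ j ∈ Finset.range (2 * n + 1),
      (-1) ^ j * ((independentSets (finRotate (2 * n)) j).card * (2 * (n - j) - 1)‼ : ℤ) := by
    rw [← h, simpleChordFree]
    congr 2
    ext π
    simp [IsChordDiagram, simpleChords, Finset.filter_eq_empty_iff]
  have h'' : (simpleChordFree n : ℝ) = ∑ j ∈ Finset.range (2 * n + 1),
      (-1) ^ j * ((independentSets (finRotate (2 * n)) j).card * (2 * (n - j) - 1)‼ : ℝ) := by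
    exact_mod_cast congrArg (Int.cast : ℤ → ℝ) h'
  rw [h'', tsum_eq_sum (s := Finset.range (2 * n + 1)), Finset.sum_div]
  · exact Finset.sum_congr rfl fun j _ => by rw [simpleChordMoment, mul_div_assoc]
  · intro j hj
    have : independentSets (finRotate (2 * n)) j = ∅ := by
      refine Finset.eq_empty_of_forall_notMem fun S hS => hj ?_
      have h1 := Finset.card_le_univ S
      rw [(mem_independentSets.1 hS).1, Fintype.card_fin] at h1
      exact Finset.mem_range.2 (by omega)
    simp [simpleChordMoment, this]

lemma doubleFactorial_two_mul_sub {n j : ℕ} (h : j < n) :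
    ((2 * (n - j) - 1)‼ : ℝ) = (2 * n - 2 * j - 1) * (2 * (n - (j + 1)) - 1)‼ := by
  obtain ⟨m, rfl⟩ := Nat.exists_eq_add_of_lt h
  have h1 : j + m + 1 - j = m + 1 := by omega
  have h2 : j + m + 1 - (j + 1) = m := by omega
  rw [h1, h2]
  cases m with
  | zero => simp; ring
  | succ m =>
    have h3 : 2 * (m + 1 + 1) - 1 = 2 * m + 1 + 2 := by omega
    have h4 : 2 * (m + 1) - 1 = 2 * m + 1 := by omega
    rw [h3, h4, Nat.doubleFactorial_add_two]
    push_cast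
    ring

lemma simpleChordMoment_succ_le {n j : ℕ} (h : j < n) :
    (j + 1) * (2 * n - 2 * j - 1) * simpleChordMoment n (j + 1) ≤
      (2 * n - 2 * j) * simpleChordMoment n j := by
  have h1 := succ_mul_card_independentSets_le (finRotate (2 * n))
    (finRotate_ne_self (by omega)) j
  rw [Fintype.card_fin] at h1
  have h2 : ((j : ℝ) + 1) * (independentSets (finRotate (2 * n)) (j + 1)).card ≤
      (independentSets (finRotate (2 * n)) j).card * (2 * n - 2 * j) := by
    have : (((2 * n - 2 * j : ℕ) : ℝ)) = 2 * n - 2 * j := by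
      rw [Nat.cast_sub (by omega)]
      push_cast
      ring
    rw [← this]
    exact_mod_cast h1
  have h3 := mul_le_mul_of_nonneg_right h2
    (show (0 : ℝ) ≤ (2 * (n - j) - 1)‼ / (2 * n - 1)‼ by positivity)
  unfold simpleChordMoment
  calc _ = _ := ?_
    _ ≤ _ := h3
    _ = _ := by ring
  rw [doubleFactorial_two_mul_sub h]
  ring

lemma le_simpleChordMoment_succ {n j : ℕ} (h : j < n) :
    (2 * n - 3 * j) * simpleChordMoment n j ≤
      (j + 1) * (2 * n - 2 * j - 1) * simpleChordMoment n (j + 1) := by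
  have h1 := le_succ_mul_card_independentSets (finRotate (2 * n))
    (finRotate_ne_self (by omega)) j
  rw [Fintype.card_fin] at h1
  have h2 : ((independentSets (finRotate (2 * n)) j).card * (2 * n - 3 * j) : ℝ) ≤
      (j + 1) * (independentSets (finRotate (2 * n)) (j + 1)).card := by
    have h4 : (2 * n - 3 * j : ℝ) ≤ ((2 * n - 3 * j : ℕ) : ℝ) := by
      rw [sub_le_iff_le_add]
      exact_mod_cast (by omega : 2 * n ≤ 2 * n - 3 * j + 3 * j)
    refine (mul_le_mul_of_nonneg_left h4 (Nat.cast_nonneg _)).trans ?_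
    exact_mod_cast h1
  have h3 := mul_le_mul_of_nonneg_right h2
    (show (0 : ℝ) ≤ (2 * (n - j) - 1)‼ / (2 * n - 1)‼ by positivity)
  unfold simpleChordMoment
  calc _ = _ := by ring
    _ ≤ _ := h3
    _ = _ := ?_
  rw [doubleFactorial_two_mul_sub h]
  ring

lemma simpleChordMoment_le {n : ℕ} (hn : 1 ≤ n) (j : ℕ) :
    simpleChordMoment n j ≤ 2 ^ j / j ! := by
  induction j with
  | zero => simp [simpleChordMoment_zero]
  | succ j ih =>
    have hj : (0 : ℝ) < j + 1 := by positivity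
    suffices h : (j + 1) * simpleChordMoment n (j + 1) ≤ 2 * simpleChordMoment n j by
      rw [Nat.factorial_succ, pow_succ]
      push_cast
      calc simpleChordMoment n (j + 1) ≤ 2 * simpleChordMoment n j / (j + 1) := by
            rwa [le_div_iff₀' hj]
        _ ≤ 2 * (2 ^ j / j !) / (j + 1) := by gcongr
        _ = _ := by field_simp
    rcases lt_or_ge j n with h | h
    · have h1 := simpleChordMoment_succ_le h
      have h2 : (j : ℝ) + 1 ≤ n := by exact_mod_cast h
      have h3 := simpleChordMoment_nonneg n j
      have h4 : (0 : ℝ) < 2 * n - 2 * j - 1 := by linarith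
      refine le_of_mul_le_mul_left ?_ h4
      nlinarith
    · have h1 := succ_mul_card_independentSets_le (finRotate (2 * n))
        (finRotate_ne_self (by omega)) j
      rw [Fintype.card_fin, Nat.sub_eq_zero_of_le (by omega), mul_zero] at h1
      have h2 : (independentSets (finRotate (2 * n)) (j + 1)).card = 0 := by
        simpa using h1
      have h3 := simpleChordMoment_nonneg n j
      have h4 : simpleChordMoment n (j + 1) = 0 := by simp [simpleChordMoment, h2]
      rw [h4, mul_zero]
      positivity

lemma tendsto_linear_div_linear (b d : ℝ) :
    Tendsto (fun n : ℕ => (2 * n - b) / (2 * n - d : ℝ)) atTop (nhds 1) := by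
  have h (c : ℝ) : Tendsto (fun n : ℕ => 2 - c / (n : ℝ)) atTop (nhds 2) := by
    simpa using (tendsto_const_div_atTop_nhds_zero_nat c).const_sub 2
  have h2 := (h b).div (h d) two_ne_zero
  rw [div_self two_ne_zero] at h2
  refine h2.congr' ?_
  filter_upwards [eventually_gt_atTop 0] with n hn
  have : (n : ℝ) ≠ 0 := by positivity
  rw [Pi.div_apply, ← mul_div_mul_right (2 - b / n : ℝ) _ this]
  congr 1 <;> field_simp

lemma tendsto_simpleChordMoment (j : ℕ) :
    Tendsto (fun n => simpleChordMoment n j) atTop (nhds (1 / j !)) := by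
  induction j with
  | zero => simp [simpleChordMoment_zero]
  | succ j ih =>
    have key (b : ℝ) : Tendsto (fun n : ℕ => (2 * n - b) / (2 * n - (2 * j + 1) : ℝ) *
        simpleChordMoment n j / (j + 1)) atTop (nhds (1 / (j + 1)!)) := by
      have h := ((tendsto_linear_div_linear b (2 * j + 1)).mul ih).div_const ((j : ℝ) + 1)
      convert h using 2
      rw [Nat.factorial_succ]
      push_cast
      field_simp
    refine tendsto_of_tendsto_of_tendsto_of_le_of_le' (key (3 * j)) (key (2 * j)) ?_ ?_
    all_goals
      filter_upwards [eventually_gt_atTop j] with n hn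
      have h2 : (j : ℝ) + 1 ≤ n := by exact_mod_cast hn
      have h3 : (0 : ℝ) < 2 * n - (2 * j + 1) := by linarith
      have h4 : (0 : ℝ) < j + 1 := by positivity
    · rw [div_le_iff₀ h4, div_mul_eq_mul_div, div_le_iff₀ h3]
      linarith [le_simpleChordMoment_succ hn]
    · rw [le_div_iff₀ h4, div_mul_eq_mul_div, le_div_iff₀ h3]
      linarith [simpleChordMoment_succ_le hn]

/-- The proportion of chord diagrams with no simple chords tends to `1/e`. -/
theorem simpleChordFree_ratio_tendsto :
    Tendsto (fun n : ℕ => (simpleChordFree n : ℝ) / ((2 * n - 1)‼ : ℝ)) atTop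
      (nhds (Real.exp (-1))) := by
  have hexp : Real.exp (-1) = ∑' j : ℕ, (-1 : ℝ) ^ j * (1 / j !) := by
    rw [Real.exp_eq_exp_ℝ, NormedSpace.exp_eq_tsum_div]
    simp only [mul_one_div]
  rw [hexp]
  refine (tendsto_tsum_of_dominated_convergence
    (f := fun (n j : ℕ) => (-1 : ℝ) ^ j * simpleChordMoment n j)
    (Real.summable_pow_div_factorial 2)
    (fun j => (tendsto_simpleChordMoment j).const_mul _) ?_).congr' ?_
  · filter_upwards [eventually_ge_atTop 1] with n hn j
    rw [norm_mul, norm_pow, norm_neg, norm_one, one_pow, one_mul, Real.norm_eq_abs,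
      abs_of_nonneg (simpleChordMoment_nonneg n j)]
    exact simpleChordMoment_le hn j
  · filter_upwards [eventually_ge_atTop 2] with n hn
    exact (simpleChordFree_ratio_eq hn).symm
end

section
/- Let $X_n$ be the number of crossings in a uniformly random chord diagram of size $n$, and let $W_n = (X_n - \mu_n)/\sigma_n$ where $\mu_n = E X_n$ and $\sigma_n^2 = \mathrm{Var}(X_n)$. Then $W_n$ converges in distribution to a standard normal random variable: for every $x \in \mathbb{R}$, $P(W_n \leq x) \to \Phi(x)$ as $n \to \infty$, where $\Phi$ is the standard normal cumulative distribution function. -/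
open MeasureTheory ProbabilityTheory Filter
open scoped Nat

section UStatistic

variable {Ω E : Type*} [MeasurableSpace Ω] [MeasurableSpace E]

/-- The pairs `i < j` of indices below `n`. -/
def ltPairs (n : ℕ) : Finset (ℕ × ℕ) :=
  (Finset.range n ×ˢ Finset.range n).filter fun p => p.1 < p.2

/-- The U-statistic of order two with kernel `H`. -/
def uStat (H : E → E → ℝ) (Y : ℕ → Ω → E) (n : ℕ) (ω : Ω) : ℝ :=
  ∑ p ∈ ltPairs n, H (Y p.1 ω) (Y p.2 ω)

/-- The first Hoeffding projection of the kernel `H`. -/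
noncomputable def hoeffdingProj (H : E → E → ℝ) (P : Measure E) (x : E) : ℝ :=
  ∫ y, H x y ∂P

/-- The completely degenerate part of the kernel `H` in its Hoeffding decomposition. -/
noncomputable def degenerateKernel (H : E → E → ℝ) (P : Measure E) (x y : E) : ℝ :=
  H x y - hoeffdingProj H P x - hoeffdingProj H P y + ∫ z, hoeffdingProj H P z ∂P

lemma mem_ltPairs {n : ℕ} {p : ℕ × ℕ} : p ∈ ltPairs n ↔ p.1 < p.2 ∧ p.2 < n := by
  simp only [ltPairs, Finset.mem_filter, Finset.mem_product, Finset.mem_range]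
  omega

lemma card_ltPairs_le (n : ℕ) : (ltPairs n).card ≤ n ^ 2 := by
  refine (Finset.card_filter_le _ _).trans ?_
  simp [sq]

lemma sum_offDiag_range (n : ℕ) (f : ℕ × ℕ → ℝ) :
    ∑ p ∈ (Finset.range n).offDiag, f p = ∑ p ∈ ltPairs n, (f p + f p.swap) := by
  have h1 : (Finset.range n).offDiag =
      ltPairs n ∪ (ltPairs n).map (Equiv.prodComm ℕ ℕ).toEmbedding := by
    ext ⟨i, j⟩
    simp only [Finset.mem_offDiag, Finset.mem_union, Finset.mem_map_equiv, mem_ltPairs,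
      Finset.mem_range, Equiv.prodComm_symm, Equiv.prodComm_apply, Prod.swap_prod_mk]
    omega
  rw [h1, Finset.sum_union, Finset.sum_map, Finset.sum_add_distrib]
  · rfl
  · rw [Finset.disjoint_left]
    rintro ⟨i, j⟩ h2 h3
    simp only [Finset.mem_map_equiv, mem_ltPairs, Equiv.prodComm_symm, Equiv.prodComm_apply,
      Prod.swap_prod_mk] at h2 h3
    omega

lemma sum_ltPairs_add (n : ℕ) (f : ℕ → ℝ) :
    ∑ p ∈ ltPairs n, (f p.1 + f p.2) = ((n : ℝ) - 1) * ∑ i ∈ Finset.range n, f i := by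
  have h2 : ∑ p ∈ (Finset.range n).offDiag, f p.1 + ∑ p ∈ (Finset.range n).diag, f p.1 =
      ∑ p ∈ Finset.range n ×ˢ Finset.range n, f p.1 := by
    rw [← Finset.diag_union_offDiag, Finset.sum_union (Finset.disjoint_diag_offDiag _), add_comm]
  rw [sum_offDiag_range n fun p => f p.1, Finset.sum_diag, Finset.sum_product] at h2
  simp only [Finset.sum_const, Finset.card_range, nsmul_eq_mul, Prod.fst_swap] at h2
  rw [← Finset.mul_sum] at h2
  linarith

lemma degenerateKernel_symm {H : E → E → ℝ} {P : Measure E} (hs : ∀ x y, H x y = H y x) (x y : E) :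
    degenerateKernel H P x y = degenerateKernel H P y x := by
  simp only [degenerateKernel, hs x y]
  ring

lemma measurable_uStat {H : E → E → ℝ} {Y : ℕ → Ω → E} (hY : ∀ i, Measurable (Y i))
    (hH : Measurable (Function.uncurry H)) (n : ℕ) : Measurable (uStat H Y n) :=
  Finset.measurable_sum _ fun p _ => hH.comp ((hY p.1).prodMk (hY p.2))

lemma indepFun_triple {μ : Measure Ω} {Y : ℕ → Ω → E}
    (hY : ∀ i, Measurable (Y i)) (hind : iIndepFun Y μ) {i j k l : ℕ}
    (hi : i ≠ j) (hk : k ≠ j) (hl : l ≠ j) :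
    IndepFun (fun ω => (Y i ω, Y k ω, Y l ω)) (Y j) μ := by
  have h := hind.indepFun_finset {i, k, l} {j} (by simp [hi.symm, hk.symm, hl.symm]) hY
  have h1 : Measurable fun z : (({i, k, l} : Finset ℕ) → E) =>
      (z ⟨i, by simp⟩, z ⟨k, by simp⟩, z ⟨l, by simp⟩) := by fun_prop
  have h2 : Measurable fun z : (({j} : Finset ℕ) → E) => z ⟨j, by simp⟩ := by fun_prop
  exact h.comp h1 h2

lemma integral_sq_standardize_sub_le {μ : Measure Ω} {A R T : Ω → ℝ}
    (hA : MemLp A 2 μ) (hR : MemLp R 2 μ) {c : ℝ} (hc : 0 < c)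
    (hT : ∀ ω, T ω = c * A ω + R ω) (hT0 : μ[T] = 0)
    (hA2 : ∫ ω, A ω ^ 2 ∂μ = 1) (hAR : ∫ ω, A ω * R ω ∂μ = 0) :
    ∫ ω, (T ω / √Var[T; μ] - A ω) ^ 2 ∂μ ≤ 2 * (∫ ω, R ω ^ 2 ∂μ) / c ^ 2 := by
  have iA := hA.integrable_sq
  have iR := hR.integrable_sq
  have iAR : Integrable (fun ω => A ω * R ω) μ := hA.integrable_mul hR
  have key : ∀ a b : ℝ, ∫ ω, (a * A ω + b * R ω) ^ 2 ∂μ = a ^ 2 + b ^ 2 * ∫ ω, R ω ^ 2 ∂μ := by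
    intro a b
    have h1 : ∀ ω, (a * A ω + b * R ω) ^ 2 =
        a ^ 2 * A ω ^ 2 + 2 * a * b * (A ω * R ω) + b ^ 2 * R ω ^ 2 := fun ω => by ring
    simp_rw [h1]
    have i1 : Integrable (fun ω => a ^ 2 * A ω ^ 2) μ := iA.const_mul _
    have i2 : Integrable (fun ω => 2 * a * b * (A ω * R ω)) μ := iAR.const_mul _
    have i3 : Integrable (fun ω => b ^ 2 * R ω ^ 2) μ := iR.const_mul _
    rw [integral_add (by exact i1.add i2) i3, integral_add i1 i2, integral_const_mul,
      integral_const_mul, integral_const_mul, hA2, hAR]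
    ring
  have hTm : AEMeasurable T μ := by
    have : T = fun ω => c * A ω + R ω := funext hT
    rw [this]
    exact ((hA.const_mul c).add hR).aemeasurable
  have hvar : Var[T; μ] = c ^ 2 + ∫ ω, R ω ^ 2 ∂μ := by
    rw [variance_of_integral_eq_zero hTm hT0]
    simp_rw [hT]
    simpa using key c 1
  set r := ∫ ω, R ω ^ 2 ∂μ with hr
  have hr0 : 0 ≤ r := integral_nonneg fun ω => sq_nonneg _
  set σ := √Var[T; μ] with hσ
  have hσ2 : σ ^ 2 = c ^ 2 + r := by rw [hσ, hvar, Real.sq_sqrt (by positivity)]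
  have hσc : c ≤ σ := by
    rw [hσ, hvar]
    exact Real.le_sqrt_of_sq_le (by linarith)
  have hσ0 : 0 < σ := hc.trans_le hσc
  have h1 : ∀ ω, (T ω / σ - A ω) ^ 2 = ((c / σ - 1) * A ω + σ⁻¹ * R ω) ^ 2 := by
    intro ω
    rw [hT]
    field_simp
    ring
  simp_rw [h1]
  rw [key]
  have h2 : (c / σ - 1) ^ 2 + σ⁻¹ ^ 2 * r = ((σ - c) ^ 2 + r) / σ ^ 2 := by
    field_simp
    ring
  rw [h2]
  have h3 : (σ - c) ^ 2 + r ≤ 2 * r := by nlinarith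
  gcongr

variable {μ : Measure Ω} [IsProbabilityMeasure μ] {P : Measure E} [IsProbabilityMeasure P]
  {Y : ℕ → Ω → E} {H : E → E → ℝ}

lemma measurable_hoeffdingProj (hH : Measurable (Function.uncurry H)) :
    Measurable (hoeffdingProj H P) :=
  (hH.stronglyMeasurable.integral_prod_right (ν := P)).measurable

lemma abs_integral_le_of_abs_le_one {f : E → ℝ} (hf : ∀ x, |f x| ≤ 1) : |∫ x, f x ∂P| ≤ 1 := by
  have := norm_integral_le_of_norm_le_const (μ := P) (f := f) (C := 1)
    (Eventually.of_forall hf)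
  simpa using this

lemma abs_degenerateKernel_le (hb : ∀ x y, |H x y| ≤ 1) (x y : E) :
    |degenerateKernel H P x y| ≤ 4 := by
  have h1 := abs_le.1 (hb x y)
  have h2 := fun x => abs_le.1 (abs_integral_le_of_abs_le_one (P := P) (hb x))
  have h3 := abs_le.1 (abs_integral_le_of_abs_le_one (P := P)
    (f := hoeffdingProj H P) fun x => abs_integral_le_of_abs_le_one (P := P) (hb x))
  have h4 := h2 x
  have h5 := h2 y
  rw [abs_le]
  simp only [degenerateKernel, hoeffdingProj] at *
  constructor <;> linarith

lemma measurable_degenerateKernel (hH : Measurable (Function.uncurry H)) :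
    Measurable (Function.uncurry (degenerateKernel H P)) := by
  have h := measurable_hoeffdingProj (P := P) hH
  exact ((hH.sub (h.comp measurable_fst)).sub (h.comp measurable_snd)).add_const _

lemma integral_degenerateKernel (hH : Measurable (Function.uncurry H))
    (hb : ∀ x y, |H x y| ≤ 1) (x : E) : ∫ y, degenerateKernel H P x y ∂P = 0 := by
  have h1 : Integrable (fun y => H x y) P :=
    .of_bound (hH.comp measurable_prodMk_left).aestronglyMeasurable 1 (.of_forall (hb x))
  have h2 : Integrable (hoeffdingProj H P) P :=
    .of_bound (measurable_hoeffdingProj hH).aestronglyMeasurable 1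
      (.of_forall fun x => abs_integral_le_of_abs_le_one (hb x))
  simp only [degenerateKernel]
  rw [integral_add, integral_sub, integral_sub]
  · simp [hoeffdingProj]
  all_goals fun_prop

lemma integral_degenerate_mul (hY : ∀ i, Measurable (Y i)) (hlaw : ∀ i, μ.map (Y i) = P)
    (hind : iIndepFun Y μ) {D : E → E → ℝ} (hD : Measurable (Function.uncurry D)) {C : ℝ}
    (hDb : ∀ x y, |D x y| ≤ C) (hD0 : ∀ x, ∫ y, D x y ∂P = 0) {G : E → E → ℝ}
    (hG : Measurable (Function.uncurry G)) {C' : ℝ} (hGb : ∀ x y, |G x y| ≤ C') {i j k l : ℕ}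
    (hi : i ≠ j) (hk : k ≠ j) (hl : l ≠ j) :
    ∫ ω, D (Y i ω) (Y j ω) * G (Y k ω) (Y l ω) ∂μ = 0 := by
  have h := indepFun_triple hY hind hi hk hl
  have hZ : Measurable fun ω => (Y i ω, Y k ω, Y l ω) := by fun_prop
  rw [indepFun_iff_map_prod_eq_prod_map_map hZ.aemeasurable (hY j).aemeasurable, hlaw] at h
  let F : (E × E × E) × E → ℝ := fun q => D q.1.1 q.2 * G q.1.2.1 q.1.2.2
  have hF : Measurable F :=
    (hD.comp (g := Function.uncurry D) (f := fun q : (E × E × E) × E => (q.1.1, q.2))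
      (by fun_prop)).mul
    (hG.comp (g := Function.uncurry G) (f := fun q : (E × E × E) × E => (q.1.2.1, q.1.2.2))
      (by fun_prop))
  have hmap : ∫ ω, D (Y i ω) (Y j ω) * G (Y k ω) (Y l ω) ∂μ =
      ∫ q, F q ∂(μ.map fun ω => ((Y i ω, Y k ω, Y l ω), Y j ω)) := by
    rw [integral_map (hZ.prodMk (hY j)).aemeasurable hF.aestronglyMeasurable]
  have : IsProbabilityMeasure (μ.map fun ω => (Y i ω, Y k ω, Y l ω)) :=
    Measure.isProbabilityMeasure_map hZ.aemeasurable
  rw [hmap, h, integral_prod]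
  · simp [F, integral_mul_const, hD0]
  · refine .of_bound hF.aestronglyMeasurable (C * C') (.of_forall fun q => ?_)
    rw [Real.norm_eq_abs, abs_mul]
    exact mul_le_mul (hDb _ _) (hGb _ _) (abs_nonneg _) ((abs_nonneg _).trans (hDb q.1.1 q.2))

lemma integral_degenerateKernel_mul_of_ne (hY : ∀ i, Measurable (Y i))
    (hlaw : ∀ i, μ.map (Y i) = P) (hind : iIndepFun Y μ) (hH : Measurable (Function.uncurry H))
    (hb : ∀ x y, |H x y| ≤ 1) (hs : ∀ x y, H x y = H y x) {G : E → E → ℝ}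
    (hG : Measurable (Function.uncurry G)) {C : ℝ} (hGb : ∀ x y, |G x y| ≤ C)
    {i j k l : ℕ} (hij : i ≠ j) (h : (k ≠ j ∧ l ≠ j) ∨ (k ≠ i ∧ l ≠ i)) :
    ∫ ω, degenerateKernel H P (Y i ω) (Y j ω) * G (Y k ω) (Y l ω) ∂μ = 0 := by
  rcases h with ⟨hk, hl⟩ | ⟨hk, hl⟩
  · exact integral_degenerate_mul hY hlaw hind (measurable_degenerateKernel hH)
      (abs_degenerateKernel_le hb) (integral_degenerateKernel hH hb) hG hGb hij hk hl
  · simp_rw [fun ω => degenerateKernel_symm (P := P) hs (Y i ω) (Y j ω)]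
    exact integral_degenerate_mul hY hlaw hind (measurable_degenerateKernel hH)
      (abs_degenerateKernel_le hb) (integral_degenerateKernel hH hb) hG hGb hij.symm hk hl

lemma tendstoInMeasure_zero_of_integral_sq {f : ℕ → Ω → ℝ}
    (hint : ∀ n, Integrable (fun ω => f n ω ^ 2) μ)
    (h : Tendsto (fun n => ∫ ω, f n ω ^ 2 ∂μ) atTop (nhds 0)) :
    TendstoInMeasure μ f atTop 0 := by
  rw [tendstoInMeasure_iff_measureReal_norm]
  intro ε hε
  have h1 : Tendsto (fun n => (ε ^ 2)⁻¹ * ∫ ω, f n ω ^ 2 ∂μ) atTop (nhds 0) := by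
    simpa using h.const_mul (ε ^ 2)⁻¹
  refine squeeze_zero (fun _ => measureReal_nonneg) (fun n => ?_) h1
  have h2 := mul_meas_ge_le_integral_of_nonneg (μ := μ)
    (.of_forall fun ω => sq_nonneg (f n ω)) (hint n) (ε ^ 2)
  have h3 : {ω | ε ≤ ‖f n ω - (0 : Ω → ℝ) ω‖} = {ω | ε ^ 2 ≤ f n ω ^ 2} := by
    ext ω
    simp only [Pi.zero_apply, sub_zero, Set.mem_ofPred_eq, Real.norm_eq_abs]
    rw [← sq_abs (f n ω), sq_le_sq₀ hε.le (abs_nonneg _)]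
  rw [h3, le_inv_mul_iff₀ (by positivity)]
  exact h2

lemma integral_sq_uStat_degenerateKernel_le (hY : ∀ i, Measurable (Y i))
    (hlaw : ∀ i, μ.map (Y i) = P) (hind : iIndepFun Y μ) (hH : Measurable (Function.uncurry H))
    (hb : ∀ x y, |H x y| ≤ 1) (hs : ∀ x y, H x y = H y x) (n : ℕ) :
    ∫ ω, uStat (degenerateKernel H P) Y n ω ^ 2 ∂μ ≤ 16 * (n : ℝ) ^ 2 := by
  have hDm := measurable_degenerateKernel (P := P) hH
  have hDb := abs_degenerateKernel_le (P := P) hb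
  have hm : ∀ p : ℕ × ℕ, Measurable fun ω => degenerateKernel H P (Y p.1 ω) (Y p.2 ω) := fun p =>
    hDm.comp ((hY p.1).prodMk (hY p.2))
  have hbd : ∀ (p q : ℕ × ℕ) (ω : Ω), |degenerateKernel H P (Y p.1 ω) (Y p.2 ω) *
      degenerateKernel H P (Y q.1 ω) (Y q.2 ω)| ≤ 16 := fun p q ω => by
    rw [abs_mul]
    nlinarith [hDb (Y p.1 ω) (Y p.2 ω), hDb (Y q.1 ω) (Y q.2 ω),
      abs_nonneg (degenerateKernel H P (Y p.1 ω) (Y p.2 ω)),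
      abs_nonneg (degenerateKernel H P (Y q.1 ω) (Y q.2 ω))]
  have hint : ∀ p q : ℕ × ℕ, Integrable (fun ω => degenerateKernel H P (Y p.1 ω) (Y p.2 ω) *
      degenerateKernel H P (Y q.1 ω) (Y q.2 ω)) μ := fun p q =>
    .of_bound ((hm p).mul (hm q)).aestronglyMeasurable 16 (.of_forall (hbd p q))
  simp_rw [uStat, sq, Finset.sum_mul_sum]
  rw [integral_finsetSum _ fun p _ => integrable_finsetSum _ fun q _ => hint p q]
  simp_rw [fun p => integral_finsetSum (μ := μ) (ltPairs n) fun q _ => hint p q]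
  have h1 : ∀ p ∈ ltPairs n, ∑ q ∈ ltPairs n, ∫ ω, degenerateKernel H P (Y p.1 ω) (Y p.2 ω) *
      degenerateKernel H P (Y q.1 ω) (Y q.2 ω) ∂μ ≤ 16 := by
    intro p hp
    rw [Finset.sum_eq_single_of_mem p hp]
    · have := norm_integral_le_of_norm_le_const (μ := μ) (C := 16)
        (f := fun ω => degenerateKernel H P (Y p.1 ω) (Y p.2 ω) *
          degenerateKernel H P (Y p.1 ω) (Y p.2 ω)) (.of_forall (hbd p p))
      rw [probReal_univ, mul_one] at this
      exact (le_abs_self _).trans this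
    · intro q hq hqp
      rw [mem_ltPairs] at hp hq
      refine integral_degenerateKernel_mul_of_ne hY hlaw hind hH hb hs hDm hDb hp.1.ne ?_
      have : ¬ (q.1 = p.1 ∧ q.2 = p.2) := fun h => hqp (Prod.ext h.1 h.2)
      omega
  calc _ ≤ ∑ p ∈ ltPairs n, (16 : ℝ) := Finset.sum_le_sum h1
    _ = 16 * ((ltPairs n).card : ℝ) := by simp [mul_comm]
    _ ≤ 16 * ((n : ℝ) * n) := by
      rw [← sq]
      have : ((ltPairs n).card : ℝ) ≤ (n : ℝ) ^ 2 := mod_cast card_ltPairs_le n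
      linarith

lemma integral_mul_uStat_degenerateKernel (hY : ∀ i, Measurable (Y i))
    (hlaw : ∀ i, μ.map (Y i) = P) (hind : iIndepFun Y μ) (hH : Measurable (Function.uncurry H))
    (hb : ∀ x y, |H x y| ≤ 1) (hs : ∀ x y, H x y = H y x) {g : E → ℝ} (hg : Measurable g) {C : ℝ}
    (hgb : ∀ y, |g y| ≤ C) (k n : ℕ) :
    ∫ ω, g (Y k ω) * uStat (degenerateKernel H P) Y n ω ∂μ = 0 := by
  have hDm := measurable_degenerateKernel (P := P) hH
  have hDb := abs_degenerateKernel_le (P := P) hb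
  have hm : ∀ p : ℕ × ℕ, Measurable fun ω => degenerateKernel H P (Y p.1 ω) (Y p.2 ω) := fun p =>
    hDm.comp ((hY p.1).prodMk (hY p.2))
  simp_rw [uStat, Finset.mul_sum, mul_comm (g _)]
  rw [integral_finsetSum]
  · refine Finset.sum_eq_zero fun p hp => ?_
    rw [mem_ltPairs] at hp
    refine integral_degenerateKernel_mul_of_ne hY hlaw hind hH hb hs (G := fun x _ => g x)
      (k := k) (l := k) (hg.comp measurable_fst) (fun x _ => hgb x) hp.1.ne ?_
    omega
  · intro p _
    refine .of_bound ((hm p).mul (hg.comp (hY k))).aestronglyMeasurable (4 * C)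
      (.of_forall fun ω => ?_)
    rw [Real.norm_eq_abs, abs_mul]
    exact mul_le_mul (hDb _ _) (hgb _) (abs_nonneg _) (by norm_num)

lemma integral_sq_sum_eq (hY : ∀ i, Measurable (Y i))
    (hlaw : ∀ i, μ.map (Y i) = P) (hind : iIndepFun Y μ) {g : E → ℝ} (hg : Measurable g) {C : ℝ}
    (hgb : ∀ y, |g y| ≤ C) (hg0 : ∫ y, g y ∂P = 0) (n : ℕ) :
    ∫ ω, (∑ k ∈ Finset.range n, g (Y k ω)) ^ 2 ∂μ = n * ∫ y, g y ^ 2 ∂P := by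
  have hint : ∀ i j, Integrable (fun ω => g (Y i ω) * g (Y j ω)) μ := fun i j => by
    refine .of_bound ((hg.comp (hY i)).mul (hg.comp (hY j))).aestronglyMeasurable (C * C)
      (.of_forall fun ω => ?_)
    rw [Real.norm_eq_abs, abs_mul]
    exact mul_le_mul (hgb _) (hgb _) (abs_nonneg _) ((abs_nonneg _).trans (hgb (Y i ω)))
  simp_rw [sq, Finset.sum_mul_sum]
  rw [integral_finsetSum _ fun p _ => integrable_finsetSum _ fun q _ => hint p q]
  simp_rw [fun p => integral_finsetSum (μ := μ) (Finset.range n) fun q _ => hint p q]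
  have h1 : ∀ i ∈ Finset.range n, ∑ j ∈ Finset.range n, ∫ ω, g (Y i ω) * g (Y j ω) ∂μ =
      ∫ y, g y * g y ∂P := by
    intro i hi
    rw [Finset.sum_eq_single_of_mem i hi]
    · rw [← hlaw i, integral_map (f := fun y => g y * g y) (hY i).aemeasurable
        (hg.mul hg).aestronglyMeasurable]
    · intro j _ hj
      exact integral_degenerate_mul hY hlaw hind (D := fun _ y => g y) (G := fun x _ => g x)
        (i := j) (j := i) (k := j) (l := j) (hg.comp measurable_snd) (fun _ y => hgb y)
        (fun _ => hg0) (hg.comp measurable_fst) (fun x _ => hgb x) hj hj hj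
  rw [Finset.sum_congr rfl h1]
  simp

/-- Central limit theorem for U-statistics of order two with a bounded symmetric kernel whose first
Hoeffding projection is not almost surely constant. -/
theorem tendsto_measureReal_uStat_le (hY : ∀ i, Measurable (Y i))
    (hlaw : ∀ i, μ.map (Y i) = P) (hind : iIndepFun Y μ) (hH : Measurable (Function.uncurry H))
    (hb : ∀ x y, |H x y| ≤ 1) (hs : ∀ x y, H x y = H y x)
    (hv : Var[hoeffdingProj H P; P] ≠ 0) (x : ℝ) :
    Tendsto (fun n => μ.real {ω | (uStat H Y n ω - ∫ ω, uStat H Y n ω ∂μ) /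
      √Var[uStat H Y n; μ] ≤ x}) atTop (nhds ((gaussianReal 0 1).real (Set.Iic x))) := by
  set h := hoeffdingProj H P with hh
  set m := ∫ z, h z ∂P with hm
  set v := Var[h; P] with hvdef
  have hv0 : 0 < v := lt_of_le_of_ne (variance_nonneg _ _) hv.symm
  have hsv : 0 < √v := Real.sqrt_pos.2 hv0
  have hhm : Measurable h := measurable_hoeffdingProj hH
  have hhb : ∀ y, |h y| ≤ 1 := fun y => abs_integral_le_of_abs_le_one (hb y)
  have hhi : Integrable h P := .of_bound hhm.aestronglyMeasurable 1 (.of_forall hhb)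
  have hDm := measurable_degenerateKernel (P := P) hH
  have hDb := abs_degenerateKernel_le (P := P) hb
  let g : E → ℝ := fun y => (h y - m) / √v
  have hgm : Measurable g := (hhm.sub_const m).div_const _
  have hgb : ∀ y, |g y| ≤ (1 + |m|) / √v := fun y => by
    simp only [g, abs_div, abs_of_pos hsv]
    gcongr
    exact (abs_sub _ _).trans (by gcongr; exact hhb y)
  have hg0 : ∫ y, g y ∂P = 0 := by
    simp only [g]
    rw [integral_div, integral_sub hhi (integrable_const m)]
    simp [hm]
  have hg2 : ∫ y, g y ^ 2 ∂P = 1 := by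
    simp only [g, div_pow]
    rw [integral_div, ← variance_eq_integral hhm.aemeasurable, Real.sq_sqrt hv0.le, div_self hv]
  have hgL : ∀ i, MemLp (fun ω => g (Y i ω)) 2 μ := fun i =>
    .of_bound (hgm.comp (hY i)).aestronglyMeasurable _ (.of_forall fun ω => hgb _)
  have hgi : ∀ i, ∫ ω, g (Y i ω) ∂μ = 0 := fun i => by
    rw [← integral_map (hY i).aemeasurable hgm.aestronglyMeasurable, hlaw, hg0]
  let A : ℕ → Ω → ℝ := fun n ω => (√n)⁻¹ * ∑ k ∈ Finset.range n, g (Y k ω)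
  let R : ℕ → Ω → ℝ := uStat (degenerateKernel H P) Y
  have hAL : ∀ n, MemLp (A n) 2 μ := fun n =>
    (memLp_finsetSum (Finset.range n) fun k _ => hgL k).const_mul _
  have hRL : ∀ n, MemLp (R n) 2 μ := fun n =>
    memLp_finsetSum (ltPairs n) fun p _ => .of_bound
      (hDm.comp ((hY p.1).prodMk (hY p.2))).aestronglyMeasurable 4 (.of_forall fun ω => hDb _ _)
  have hA0 : ∀ n, ∫ ω, A n ω ∂μ = 0 := fun n => by
    simp only [A]
    rw [integral_const_mul, integral_finsetSum _ fun k _ => (hgL k).integrable one_le_two]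
    simp [hgi]
  have hR0 : ∀ n, ∫ ω, R n ω ∂μ = 0 := fun n => by
    simpa using integral_mul_uStat_degenerateKernel hY hlaw hind hH hb hs (g := fun _ => 1)
      measurable_const (C := 1) (by simp) 0 n
  have hAR : ∀ n, ∫ ω, A n ω * R n ω ∂μ = 0 := fun n => by
    simp only [A, mul_assoc, Finset.sum_mul]
    have hi : ∀ k, Integrable (fun ω => g (Y k ω) * R n ω) μ :=
      fun k => (hgL k).integrable_mul (hRL n)
    rw [integral_const_mul, integral_finsetSum _ fun k _ => hi k]
    simp only [R]
    simp [integral_mul_uStat_degenerateKernel hY hlaw hind hH hb hs hgm hgb]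
  have hA2 : ∀ n, 1 ≤ n → ∫ ω, A n ω ^ 2 ∂μ = 1 := fun n hn => by
    have : (n : ℝ) ≠ 0 := by positivity
    simp only [A, mul_pow]
    rw [integral_const_mul, integral_sq_sum_eq hY hlaw hind hgm hgb hg0, hg2, inv_pow,
      Real.sq_sqrt (by positivity)]
    field_simp
  let c : ℕ → ℝ := fun n => ((n : ℝ) - 1) * √v * √n
  have hdec : ∀ n ω, uStat H Y n ω = (ltPairs n).card * m + (c n * A n ω + R n ω) := by
    intro n ω
    have h1 : c n * A n ω = √v * (((n : ℝ) - 1) * ∑ k ∈ Finset.range n, g (Y k ω)) := by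
      rcases Nat.eq_zero_or_pos n with rfl | hn
      · simp [A]
      · have : 0 < √(n : ℝ) := Real.sqrt_pos.2 (by positivity)
        simp only [c, A]
        field_simp
    rw [h1, ← sum_ltPairs_add n fun k => g (Y k ω), Finset.mul_sum]
    simp only [R, uStat]
    rw [← Finset.sum_add_distrib, ← nsmul_eq_mul, ← Finset.sum_const, ← Finset.sum_add_distrib]
    refine Finset.sum_congr rfl fun p _ => ?_
    simp only [g, degenerateKernel, ← hh, ← hm]
    field_simp
    ring
  have hmean : ∀ n, ∫ ω, uStat H Y n ω ∂μ = (ltPairs n).card * m := fun n => by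
    have i1 := (hAL n).integrable one_le_two
    have i2 := (hRL n).integrable one_le_two
    have i3 : Integrable (fun ω => c n * A n ω) μ := i1.const_mul _
    have i4 : Integrable (fun ω => c n * A n ω + R n ω) μ := i3.add i2
    simp_rw [hdec]
    rw [integral_add (integrable_const _) i4, integral_add i3 i2, integral_const_mul (c n), hA0,
      hR0]
    simp
  have hSm : ∀ n, Measurable (uStat H Y n) := measurable_uStat hY hH
  let W : ℕ → Ω → ℝ := fun n ω =>
    (uStat H Y n ω - ∫ ω, uStat H Y n ω ∂μ) / √Var[uStat H Y n; μ]
  have hWm : ∀ n, Measurable (W n) := fun n => ((hSm n).sub_const _).div_const _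
  have hT : ∀ n ω, uStat H Y n ω - ∫ ω, uStat H Y n ω ∂μ = c n * A n ω + R n ω := fun n ω => by
    rw [hmean, hdec]
    ring
  have hbound : ∀ n, 2 ≤ n → ∫ ω, (W n - A n) ω ^ 2 ∂μ ≤ 128 / v * (n : ℝ)⁻¹ := by
    intro n hn
    have hn' : (2 : ℝ) ≤ n := mod_cast hn
    have hsn : 0 < √(n : ℝ) := Real.sqrt_pos.2 (by linarith)
    have hc : 0 < c n := mul_pos (mul_pos (by linarith) hsv) hsn
    have h1 := integral_sq_standardize_sub_le (hAL n) (hRL n) hc (hT n) (by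
      have i1 := (hAL n).integrable one_le_two
      have i2 := (hRL n).integrable one_le_two
      simp_rw [hT]
      rw [integral_add (i1.const_mul _) i2, integral_const_mul, hA0, hR0]
      simp) (hA2 n (by omega)) (hAR n)
    rw [variance_sub_const (hSm n).aestronglyMeasurable] at h1
    refine h1.trans ?_
    have h2 := integral_sq_uStat_degenerateKernel_le hY hlaw hind hH hb hs n
    have h3 : c n ^ 2 = ((n : ℝ) - 1) ^ 2 * v * n := by
      simp only [c, mul_pow]
      rw [Real.sq_sqrt hv0.le, Real.sq_sqrt (by linarith)]
    have h4 : (n : ℝ) ^ 2 * v * n / 4 ≤ c n ^ 2 := by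
      rw [h3]
      have : (n : ℝ) ^ 2 / 4 ≤ ((n : ℝ) - 1) ^ 2 := by nlinarith
      calc (n : ℝ) ^ 2 * v * n / 4 = (n : ℝ) ^ 2 / 4 * (v * n) := by ring
        _ ≤ ((n : ℝ) - 1) ^ 2 * (v * n) := by gcongr
        _ = _ := by ring
    calc 2 * (∫ ω, R n ω ^ 2 ∂μ) / c n ^ 2
        ≤ 2 * (16 * (n : ℝ) ^ 2) / ((n : ℝ) ^ 2 * v * n / 4) := by gcongr
      _ = 128 / v * (n : ℝ)⁻¹ := by
        field_simp
        norm_num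
  have hlim : Tendsto (fun n => ∫ ω, (W n - A n) ω ^ 2 ∂μ) atTop (nhds 0) := by
    have h1 : Tendsto (fun n : ℕ => 128 / v * (n : ℝ)⁻¹) atTop (nhds 0) := by
      simpa using (tendsto_inv_atTop_nhds_zero_nat (𝕜 := ℝ)).const_mul (128 / v)
    refine squeeze_zero' (.of_forall fun n => integral_nonneg fun ω => sq_nonneg _) ?_ h1
    filter_upwards [eventually_ge_atTop 2] with n hn using hbound n hn
  have hWL : ∀ n, MemLp (W n) 2 μ := fun n => by
    have : W n = fun ω => (√Var[uStat H Y n; μ])⁻¹ * (c n * A n ω + R n ω) := by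
      funext ω
      simp only [W, hT]
      ring
    rw [this]
    exact (((hAL n).const_mul _).add (hRL n)).const_mul _
  have hmeas : TendstoInMeasure μ (fun n => W n - A n) atTop 0 :=
    tendstoInMeasure_zero_of_integral_sq (fun n => ((hWL n).sub (hAL n)).integrable_sq) hlim
  have hclt : TendstoInDistribution A atTop id (fun _ => μ) (gaussianReal 0 1) := by
    refine tendstoInDistribution_inv_sqrt_mul_sum (X := fun k ω => g (Y k ω)) ⟨by fun_prop, by simp⟩
      (hgi 0) ?_ (hind.comp (fun _ => g) fun _ => hgm) fun i => ?_
    · have : ∫ ω, (fun y => g y ^ 2) (Y 0 ω) ∂μ = 1 := by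
        rw [← integral_map (hY 0).aemeasurable (hgm.pow_const 2).aestronglyMeasurable, hlaw, hg2]
      exact this
    · exact IdentDistrib.comp (f := Y i) (g := Y 0)
        ⟨(hY i).aemeasurable, (hY 0).aemeasurable, by rw [hlaw, hlaw]⟩ hgm
  have hW := tendstoInDistribution_of_tendstoInMeasure_sub W id hclt hmeas
    fun n => (hWm n).aemeasurable
  have hfr : (((⟨(gaussianReal 0 1).map id, Measure.isProbabilityMeasure_map aemeasurable_id⟩ :
      ProbabilityMeasure ℝ) : Measure ℝ)) (frontier (Set.Iic x)) = 0 := by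
    have := nullSingletonClass_gaussianReal (μ := 0) (v := 1) one_ne_zero
    simp
  have h1 : Tendsto (fun n => (μ.map (W n)) (Set.Iic x)) atTop
      (nhds (gaussianReal 0 1 (Set.Iic x))) := by
    simpa using ProbabilityMeasure.tendsto_measure_of_null_frontier_of_tendsto' hW.tendsto hfr
  refine ((ENNReal.tendsto_toReal (measure_ne_top _ _)).comp h1).congr fun n => ?_
  rw [Function.comp_apply, Measure.map_apply (hWm n) measurableSet_Iic]
  rfl

end UStatistic

section Diagrams

open Equiv

/-- The number of pairs of chords of `τ` that cross when the endpoint `p` is placed at `V p`. -/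
def crossingsAt {I α : Type*} [Fintype I] [LinearOrder α] (V : I → α) (τ : Perm I) : ℕ :=
  ((Finset.univ : Finset (I × I)).filter
    (fun p => V p.1 < V p.2 ∧ V p.2 < V (τ p.1) ∧ V (τ p.1) < V (τ p.2))).card

lemma crossings_eq_crossingsAt {n : ℕ} (π : Perm (Fin (2 * n))) :
    crossings π = crossingsAt id π := by
  refine Finset.card_nbij' (fun q => (q.1, q.2.1)) (fun p => (p.1, p.2, π p.1, π p.2)) ?_ ?_ ?_ ?_
  · rintro ⟨i, j, k, l⟩ h
    simp only [Finset.coe_filter, Finset.mem_univ, true_and, Set.mem_ofPred_eq] at h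
    obtain ⟨h1, h2, h3, rfl, rfl⟩ := h
    simp [h1, h2, h3]
  · rintro ⟨i, j⟩ h
    simpa using h
  · rintro ⟨i, j, k, l⟩ h
    simp only [Finset.coe_filter, Finset.mem_univ, true_and, Set.mem_ofPred_eq] at h
    obtain ⟨h1, h2, h3, rfl, rfl⟩ := h
    rfl
  · rintro ⟨i, j⟩ h
    rfl

variable {I J α β : Type*} [Fintype I] [Fintype J] [LinearOrder α] [LinearOrder β]

lemma crossingsAt_strictMono_comp {f : α → β} (hf : StrictMono f) (V : I → α) (τ : Perm I) :
    crossingsAt (f ∘ V) τ = crossingsAt V τ := by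
  simp [crossingsAt, hf.lt_iff_lt]

lemma crossingsAt_permCongr (t : I ≃ J) (V : J → α) (τ : Perm I) :
    crossingsAt V (t.permCongr τ) = crossingsAt (V ∘ t) τ := by
  unfold crossingsAt
  refine (Finset.card_equiv (prodCongr t t) ?_).symm
  rintro ⟨i, j⟩
  rw [Finset.mem_filter, Finset.mem_filter]
  simp

lemma exists_equiv_fin_strictMono {N : ℕ} (hI : Fintype.card I = N) {V : I → α}
    (hV : Function.Injective V) :
    ∃ (t : I ≃ Fin N) (f : Fin N → α), StrictMono f ∧ V = f ∘ t := by
  let e := Fintype.equivFinOfCardEq hI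
  let s := Tuple.sort (V ∘ e.symm)
  refine ⟨e.trans s.symm, (V ∘ e.symm) ∘ s, ?_, ?_⟩
  · exact (Tuple.monotone_sort _).strictMono_of_injective
      ((hV.comp e.symm.injective).comp s.injective)
  · ext i
    simp

variable [DecidableEq I] {n : ℕ}

open Classical in
lemma card_perm_crossingsAt_comp (hI : Fintype.card I = 2 * n) {V : I → α}
    (hV : Function.Injective V) (τ : Perm I) (A : Set ℕ) :
    (Finset.univ.filter fun ρ : Perm I => crossingsAt (V ∘ ρ) τ ∈ A).card =
      (Finset.univ.filter fun t : I ≃ Fin (2 * n) => crossings (t.permCongr τ) ∈ A).card := by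
  obtain ⟨t, f, hf, rfl⟩ := exists_equiv_fin_strictMono hI hV
  refine Finset.card_equiv ((Equiv.refl I).equivCongr t) fun ρ => ?_
  simp only [Finset.mem_filter, Finset.mem_univ, true_and]
  rw [crossings_eq_crossingsAt, crossingsAt_permCongr, Function.comp_assoc,
    crossingsAt_strictMono_comp hf]
  rfl

lemma cycleType_of_involutive {σ : Perm I} (h : ∀ i, σ (σ i) = i) (h0 : ∀ i, σ i ≠ i)
    (hI : Fintype.card I = 2 * n) : σ.cycleType = Multiset.replicate n 2 := by
  have h1 : σ ^ 2 = 1 := by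
    ext i
    simp [sq, h]
  have h2 := Perm.cycleType_of_pow_prime_eq_one (p := 2) h1
  have h3 := σ.sum_cycleType
  have h4 : σ.support = Finset.univ := by
    ext i
    simp [h0]
  rw [h2, h4, Multiset.sum_replicate, Finset.card_univ, hI, smul_eq_mul] at h3
  rw [h2]
  congr 1
  omega

open Classical in
lemma exists_card_permCongr_eq_mul (hI : Fintype.card I = 2 * n) {τ : Perm I}
    (h : ∀ i, τ (τ i) = i) (h0 : ∀ i, τ i ≠ i) :
    ∃ c : ℕ, ∀ B : Set (Perm (Fin (2 * n))),
      (Finset.univ.filter fun t : I ≃ Fin (2 * n) => t.permCongr τ ∈ B).card =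
        c * (Finset.univ.filter fun π => IsChordDiagram π ∧ π ∈ B).card := by
  have hcd : ∀ t : I ≃ Fin (2 * n), IsChordDiagram (t.permCongr τ) := fun t => by
    refine ⟨fun i => by simp [h], fun i hi => h0 (t.symm i) ?_⟩
    rw [permCongr_apply, ← Equiv.eq_symm_apply] at hi
    exact hi
  let e := Fintype.equivFinOfCardEq hI
  let F : Perm (Fin (2 * n)) → Finset (I ≃ Fin (2 * n)) := fun π =>
    Finset.univ.filter fun t => t.permCongr τ = π
  refine ⟨(F (e.permCongr τ)).card, fun B => ?_⟩
  rw [Finset.card_eq_sum_card_fiberwise (f := fun t => t.permCongr τ)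
    (t := Finset.univ.filter fun π => IsChordDiagram π ∧ π ∈ B), mul_comm (F _).card]
  · refine Finset.sum_const_nat fun π hπ => ?_
    simp only [Finset.mem_filter, Finset.mem_univ, true_and] at hπ
    have hconj : IsConj (e.permCongr τ) π := by
      rw [Perm.isConj_iff_cycleType_eq,
        cycleType_of_involutive (hcd e).1 (hcd e).2 (Fintype.card_fin _),
        cycleType_of_involutive hπ.1.1 hπ.1.2 (Fintype.card_fin _)]
    obtain ⟨g, rfl⟩ := isConj_iff.1 hconj
    refine (Finset.card_equiv ((Equiv.refl I).equivCongr g) fun t => ?_).symm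
    have h1 : ((Equiv.refl I).equivCongr g t).permCongr τ = g * t.permCongr τ * g⁻¹ := by
      ext i
      simp [Perm.mul_apply]
    simp only [F, Finset.mem_filter, Finset.mem_univ, true_and, h1, mul_left_inj, mul_right_inj]
    constructor
    · intro h2
      rw [h2]
      exact ⟨hπ.2, rfl⟩
    · exact fun h2 => h2.2
  · intro t ht
    simp only [Finset.coe_filter, Finset.mem_univ, true_and, Set.mem_ofPred_eq] at ht ⊢
    exact ⟨hcd t, ht⟩

end Diagrams

section RandomPlacement

open Equiv

instance {N : ℕ} : DiscreteMeasurableSpace (Perm (Fin N)) := ⟨fun _ => trivial⟩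

open Classical in
lemma uniformCD_apply (n : ℕ) (B : Set (Perm (Fin (2 * n)))) :
    uniformCD n B = (Finset.univ.filter fun π => IsChordDiagram π ∧ π ∈ B).card /
      (Finset.univ.filter fun π : Perm (Fin (2 * n)) => IsChordDiagram π).card := by
  have h := uniformOn_apply_finset
    (s := Finset.univ.filter fun π : Perm (Fin (2 * n)) => IsChordDiagram π)
    (t := Finset.univ.filter fun π => π ∈ B)
  rw [← Finset.filter_and] at h
  simpa [uniformCD] using h

variable {I : Type*} [Fintype I]

lemma measurable_crossingsAt (τ : Perm I) : Measurable fun V : I → ℝ => crossingsAt V τ := by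
  simp only [crossingsAt, Finset.card_filter]
  refine Finset.measurable_sum _ fun p _ => Measurable.ite ?_ measurable_const measurable_const
  have h : ∀ i j : I, MeasurableSet {V : I → ℝ | V i < V j} := fun i j =>
    measurableSet_lt (by fun_prop) (by fun_prop)
  exact (h _ _).inter ((h _ _).inter (h _ _))

variable {P : Measure ℝ} [IsProbabilityMeasure P]

lemma ae_injective_infinitePi [NullSingletonClass P] :
    ∀ᵐ V ∂Measure.infinitePi fun _ : I => P, Function.Injective V := by
  have h : ∀ i j : I, i ≠ j → ∀ᵐ V ∂Measure.infinitePi fun _ : I => P, V i ≠ V j := by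
    intro i j hij
    have hd : MeasurableSet {z : ℝ × ℝ | z.1 = z.2} :=
      measurableSet_eq_fun measurable_fst measurable_snd
    have hm : Measurable fun V : I → ℝ => (V i, V j) := by fun_prop
    refine (ae_map_iff hm.aemeasurable hd.compl).1 ?_
    rw [Measure.infinitePi_map_eval_prod hij]
    refine compl_mem_ae_iff.2 ((Measure.measure_prod_null hd).2 (.of_forall fun x => ?_))
    have : Prod.mk x ⁻¹' {z : ℝ × ℝ | z.1 = z.2} = {x} := by
      ext y
      simp [eq_comm]
    simp only [this, measure_singleton, Pi.zero_apply]
  have h' : ∀ᵐ V ∂Measure.infinitePi fun _ : I => P, ∀ i j : I, i ≠ j → V i ≠ V j := by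
    simpa only [ae_all_iff] using h
  filter_upwards [h'] with V hV i j hij
  by_contra hne
  exact hV i j hne hij

variable [DecidableEq I] {n : ℕ}

open Classical in
lemma card_perm_mul_infinitePi_crossingsAt [NullSingletonClass P]
    (hI : Fintype.card I = 2 * n) (τ : Perm I) (A : Set ℕ) :
    (Fintype.card (Perm I) : ENNReal) *
        Measure.infinitePi (fun _ : I => P) {V | crossingsAt V τ ∈ A} =
      (Finset.univ.filter fun t : I ≃ Fin (2 * n) => crossings (t.permCongr τ) ∈ A).card := by
  have hmeas : ∀ ρ : Perm I, MeasurableSet {V : I → ℝ | crossingsAt (V ∘ ρ) τ ∈ A} := fun ρ =>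
    ((measurable_crossingsAt τ).comp (g := fun V : I → ℝ => crossingsAt V τ)
      (f := fun V : I → ℝ => V ∘ ρ) (by unfold Function.comp; fun_prop))
      (MeasurableSet.of_discrete (s := A))
  have hinv : ∀ ρ : Perm I, Measure.infinitePi (fun _ : I => P) {V | crossingsAt (V ∘ ρ) τ ∈ A} =
      Measure.infinitePi (fun _ : I => P) {V | crossingsAt V τ ∈ A} := by
    intro ρ
    conv_rhs => rw [← Measure.map_infinitePi_infinitePi_of_inj (P := fun _ : I => P) ρ.injective]
    have hm : Measurable fun (V : I → ℝ) i => V (ρ i) := by fun_prop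
    exact (Measure.map_apply hm (hmeas 1)).symm
  calc (Fintype.card (Perm I) : ENNReal) *
        Measure.infinitePi (fun _ : I => P) {V | crossingsAt V τ ∈ A}
      = ∑ ρ : Perm I, Measure.infinitePi (fun _ : I => P) {V | crossingsAt (V ∘ ρ) τ ∈ A} := by
        simp [hinv]
    _ = ∑ ρ : Perm I, ∫⁻ V, {V | crossingsAt (V ∘ ρ) τ ∈ A}.indicator 1 V
          ∂Measure.infinitePi (fun _ : I => P) := by
        simp [hmeas]
    _ = ∫⁻ V, ∑ ρ : Perm I, {V | crossingsAt (V ∘ ρ) τ ∈ A}.indicator 1 V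
          ∂Measure.infinitePi (fun _ : I => P) := by
        rw [lintegral_finsetSum _ fun ρ _ => measurable_one.indicator (hmeas ρ)]
    _ = ∫⁻ _, (Finset.univ.filter fun t : I ≃ Fin (2 * n) => crossings (t.permCongr τ) ∈ A).card
          ∂Measure.infinitePi (fun _ : I => P) := by
        refine lintegral_congr_ae ?_
        filter_upwards [ae_injective_infinitePi (P := P)] with V hV
        rw [← card_perm_crossingsAt_comp hI hV]
        simp [Set.indicator_apply]
    _ = _ := by simp

theorem infinitePi_crossingsAt [NullSingletonClass P]
    (hI : Fintype.card I = 2 * n) {τ : Perm I} (h : ∀ i, τ (τ i) = i) (h0 : ∀ i, τ i ≠ i) :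
    (Measure.infinitePi fun _ : I => P).map (fun V => crossingsAt V τ) =
      (uniformCD n).map crossings := by
  classical
  ext A hA
  rw [Measure.map_apply (measurable_crossingsAt τ) hA,
    Measure.map_apply (Measurable.of_discrete) hA, uniformCD_apply]
  obtain ⟨c, hc⟩ := exists_card_permCongr_eq_mul hI h h0
  have key := fun A : Set ℕ => (card_perm_mul_infinitePi_crossingsAt (P := P) hI τ A).trans
    (congrArg Nat.cast (hc (crossings ⁻¹' A)))
  have h1 := key Set.univ
  simp only [Set.mem_univ, Set.ofPred_true, measure_univ, mul_one, Set.preimage_univ, and_true,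
    Nat.cast_mul] at h1
  have h2 := key A
  rw [h1, Nat.cast_mul, mul_assoc] at h2
  have h3 : (Fintype.card (Perm I) : ENNReal) ≠ 0 := by simp [Fintype.card_ne_zero]
  rw [h1, mul_ne_zero_iff] at h3
  rw [ENNReal.mul_right_inj h3.1 (ENNReal.natCast_ne_top _)] at h2
  rw [ENNReal.eq_div_iff h3.2 (ENNReal.natCast_ne_top _)]
  exact h2

end RandomPlacement

section CrossingKernel

/-- The kernel that equals `1` if the chord with endpoints `x.1, x.2` crosses the chord with
endpoints `y.1, y.2`, and `0` if it does not, provided that the four endpoints are distinct. -/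
noncomputable def crossingKernel (x y : ℝ × ℝ) : ℝ :=
  (1 - (Real.sign (y.1 - x.1) * Real.sign (y.1 - x.2)) *
    (Real.sign (y.2 - x.1) * Real.sign (y.2 - x.2))) / 2

lemma abs_sign_le_one (r : ℝ) : |Real.sign r| ≤ 1 := by
  rcases Real.sign_apply_eq r with h | h | h <;> simp [h]

lemma measurable_sign : Measurable Real.sign :=
  Measurable.ite measurableSet_Iio measurable_const
    (Measurable.ite measurableSet_Ioi measurable_const measurable_const)

lemma crossingKernel_symm (x y : ℝ × ℝ) : crossingKernel x y = crossingKernel y x := by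
  have h : ∀ a b : ℝ, Real.sign (a - b) = -Real.sign (b - a) := fun a b => by
    rw [← Real.sign_neg, neg_sub]
  simp only [crossingKernel]
  rw [h y.1 x.1, h y.1 x.2, h y.2 x.1, h y.2 x.2]
  ring

lemma abs_crossingKernel_le_one (x y : ℝ × ℝ) : |crossingKernel x y| ≤ 1 := by
  have h : |(Real.sign (y.1 - x.1) * Real.sign (y.1 - x.2)) *
      (Real.sign (y.2 - x.1) * Real.sign (y.2 - x.2))| ≤ 1 := by
    simp only [abs_mul]
    refine mul_le_one₀ (mul_le_one₀ ?_ ?_ ?_) (by positivity) (mul_le_one₀ ?_ ?_ ?_)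
    all_goals first | exact abs_sign_le_one _ | positivity
  rw [abs_le] at h
  rw [crossingKernel, abs_le]
  constructor <;> linarith [h.1, h.2]

lemma measurable_crossingKernel : Measurable (Function.uncurry crossingKernel) := by
  have h := measurable_sign
  unfold Function.uncurry crossingKernel
  fun_prop

/-- The uniform law on `[0, 1]`. -/
noncomputable def unitLaw : Measure ℝ := volume.restrict (Set.Icc 0 1)

instance : IsProbabilityMeasure unitLaw := ⟨by simp [unitLaw]⟩

instance : NullSingletonClass unitLaw := by
  unfold unitLaw
  infer_instance

lemma unitLaw_Ioo {a b : ℝ} (ha : 0 ≤ a) (hb : b ≤ 1) :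
    unitLaw (Set.Ioo a b) = ENNReal.ofReal (b - a) := by
  rw [unitLaw, Measure.restrict_apply measurableSet_Ioo, Set.inter_eq_left.2, Real.volume_Ioo]
  exact fun c hc => ⟨ha.trans hc.1.le, hc.2.le.trans hb⟩

lemma integral_sign_mul_sign {a b : ℝ} (ha : 0 ≤ a) (hab : a ≤ b) (hb : b ≤ 1) :
    ∫ c, Real.sign (c - a) * Real.sign (c - b) ∂unitLaw = 1 - 2 * (b - a) := by
  have h : (fun c => Real.sign (c - a) * Real.sign (c - b)) =ᵐ[unitLaw]
      fun c => 1 - 2 * (Set.Ioo a b).indicator 1 c := by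
    have h1 : ∀ r : ℝ, ∀ᵐ c ∂unitLaw, c ≠ r := fun r => by simp [ae_iff]
    filter_upwards [h1 a, h1 b] with c hca hcb
    rcases lt_or_gt_of_ne hca with h2 | h2 <;> rcases lt_or_gt_of_ne hcb with h3 | h3
    · rw [Real.sign_of_neg (sub_neg.2 h2), Real.sign_of_neg (sub_neg.2 h3),
        Set.indicator_of_notMem fun h => h2.not_gt h.1]
      norm_num
    · linarith
    · rw [Real.sign_of_pos (sub_pos.2 h2), Real.sign_of_neg (sub_neg.2 h3),
        Set.indicator_of_mem (Set.mem_Ioo.2 ⟨h2, h3⟩)]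
      norm_num
    · rw [Real.sign_of_pos (sub_pos.2 h2), Real.sign_of_pos (sub_pos.2 h3),
        Set.indicator_of_notMem fun h => h3.not_gt h.2]
      norm_num
  have hi : Integrable (fun c => 2 * (Set.Ioo a b).indicator (1 : ℝ → ℝ) c) unitLaw :=
    ((integrable_const (1 : ℝ)).indicator measurableSet_Ioo).const_mul 2
  rw [integral_congr_ae h, integral_sub (integrable_const _) hi, integral_const_mul,
    integral_indicator_one measurableSet_Ioo, measureReal_def, unitLaw_Ioo ha hb,
    ENNReal.toReal_ofReal (by linarith)]
  simp

lemma hoeffdingProj_crossingKernel {a b : ℝ} (ha : 0 ≤ a) (hab : a ≤ b) (hb : b ≤ 1) :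
    hoeffdingProj crossingKernel (unitLaw.prod unitLaw) (a, b) =
      (1 - (1 - 2 * (b - a)) ^ 2) / 2 := by
  have h := measurable_sign
  have hi : Integrable (fun c => Real.sign (c - a) * Real.sign (c - b)) unitLaw := by
    refine .of_bound (by fun_prop) 1 (.of_forall fun c => ?_)
    rw [Real.norm_eq_abs, abs_mul]
    exact mul_le_one₀ (abs_sign_le_one _) (abs_nonneg _) (abs_sign_le_one _)
  simp only [hoeffdingProj, crossingKernel]
  rw [integral_div, integral_sub (integrable_const _) (hi.mul_prod hi), integral_prod_mul
    (fun c => Real.sign (c - a) * Real.sign (c - b))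
    (fun c => Real.sign (c - a) * Real.sign (c - b)), integral_sign_mul_sign ha hab hb]
  simp [sq]

lemma variance_hoeffdingProj_crossingKernel_ne_zero :
    Var[hoeffdingProj crossingKernel (unitLaw.prod unitLaw); unitLaw.prod unitLaw] ≠ 0 := by
  intro h0
  have hL : MemLp (hoeffdingProj crossingKernel (unitLaw.prod unitLaw)) 2
      (unitLaw.prod unitLaw) :=
    .of_bound (measurable_hoeffdingProj measurable_crossingKernel).aestronglyMeasurable 1
      (.of_forall fun x => abs_integral_le_of_abs_le_one (abs_crossingKernel_le_one x))
  have hae := ae_eq_integral_of_variance_eq_zero hL h0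
  have hex : ∀ a b c d : ℝ, 0 ≤ a → a < b → b ≤ 1 → 0 ≤ c → c < d → d ≤ 1 →
      ∃ x ∈ Set.Ioo a b ×ˢ Set.Ioo c d, hoeffdingProj crossingKernel (unitLaw.prod unitLaw) x =
        ∫ z, hoeffdingProj crossingKernel (unitLaw.prod unitLaw) z ∂unitLaw.prod unitLaw := by
    intro a b c d ha hab hb hc hcd hd
    have hpos : (unitLaw.prod unitLaw) (Set.Ioo a b ×ˢ Set.Ioo c d) ≠ 0 := by
      rw [Measure.prod_prod, unitLaw_Ioo ha hb, unitLaw_Ioo hc hd]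
      simp [hab, hcd]
    exact ((frequently_ae_mem_iff.2 hpos).and_eventually hae).exists
  obtain ⟨⟨a, b⟩, ⟨⟨ha, ha'⟩, hb, hb'⟩, hx⟩ := hex 0 (1 / 8) (1 / 8) (1 / 4)
    (by norm_num) (by norm_num) (by norm_num) (by norm_num) (by norm_num) (by norm_num)
  obtain ⟨⟨c, d⟩, ⟨⟨hc, hc'⟩, hd, hd'⟩, hy⟩ := hex 0 (1 / 8) (1 / 2) (5 / 8)
    (by norm_num) (by norm_num) (by norm_num) (by norm_num) (by norm_num) (by norm_num)
  dsimp only at ha ha' hb hb' hc hc' hd hd'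
  rw [← hy, hoeffdingProj_crossingKernel ha.le (by linarith) (by linarith),
    hoeffdingProj_crossingKernel hc.le (by linarith) (by linarith)] at hx
  nlinarith

end CrossingKernel

section Coupling

lemma crossingKernel_eq_sum {V W : Bool → ℝ} (h : ∀ b c, V b ≠ W c) :
    ((∑ b, ∑ c, if V b < W c ∧ W c < V (!b) ∧ V (!b) < W (!c) then 1 else 0) +
      ∑ b, ∑ c, if W b < V c ∧ V c < W (!b) ∧ W (!b) < V (!c) then 1 else 0 : ℝ) =
      crossingKernel (V false, V true) (W false, W true) := by
  have key : ∀ a b : ℝ, a ≠ b → (a < b ∧ ¬ b < a ∧ Real.sign (b - a) = 1) ∨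
      (b < a ∧ ¬ a < b ∧ Real.sign (b - a) = -1) := by
    intro a b hab
    rcases lt_or_gt_of_ne hab with h | h
    · exact .inl ⟨h, h.not_gt, Real.sign_of_pos (sub_pos.2 h)⟩
    · exact .inr ⟨h, h.not_gt, Real.sign_of_neg (sub_neg.2 h)⟩
  simp only [Fintype.sum_bool, crossingKernel, Bool.not_true, Bool.not_false]
  rcases key _ _ (h false false) with ⟨h1, h1', e1⟩ | ⟨h1, h1', e1⟩ <;>
  rcases key _ _ (h false true) with ⟨h2, h2', e2⟩ | ⟨h2, h2', e2⟩ <;>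
  rcases key _ _ (h true false) with ⟨h3, h3', e3⟩ | ⟨h3, h3', e3⟩ <;>
  rcases key _ _ (h true true) with ⟨h4, h4', e4⟩ | ⟨h4, h4', e4⟩ <;>
  first
  | simp [h1, h2, h3, h4, h1', h2', h3', h4', e1, e2, e3, e4]; done
  | linarith

/-- The chord diagram on `Fin n × Bool` joining the two points over each `i`. -/
def pairing (n : ℕ) : Equiv.Perm (Fin n × Bool) := (Equiv.refl (Fin n)).prodCongr Equiv.boolNot

lemma pairing_apply {n : ℕ} (p : Fin n × Bool) : pairing n p = (p.1, !p.2) := rfl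

lemma crossingsAt_pairing {n : ℕ} {ω : ℕ → Bool → ℝ}
    (h : Function.Injective fun p : Fin n × Bool => ω p.1 p.2) :
    (crossingsAt (fun p : Fin n × Bool => ω p.1 p.2) (pairing n) : ℝ) =
      uStat crossingKernel (fun i (ω : ℕ → Bool → ℝ) => (ω i false, ω i true)) n ω := by
  let G : ℕ × ℕ → ℝ := fun p => ∑ b, ∑ c, if ω p.1 b < ω p.2 c ∧ ω p.2 c < ω p.1 (!b) ∧
    ω p.1 (!b) < ω p.2 (!c) then 1 else 0
  have h1 : (crossingsAt (fun p : Fin n × Bool => ω p.1 p.2) (pairing n) : ℝ) =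
      ∑ p ∈ Finset.range n ×ˢ Finset.range n, G p := by
    rw [Finset.sum_product, Finset.sum_range]
    simp_rw [Finset.sum_range]
    rw [crossingsAt, Finset.card_filter, Fintype.sum_prod_type, Fintype.sum_prod_type]
    push_cast
    refine Finset.sum_congr rfl fun i _ => ?_
    simp_rw [Fintype.sum_prod_type, pairing_apply]
    exact Finset.sum_comm
  have h2 : ∑ p ∈ (Finset.range n).diag, G p = 0 := by
    rw [Finset.sum_diag]
    exact Finset.sum_eq_zero fun i _ => by
      simp only [G, Fintype.sum_bool, Bool.not_true, Bool.not_false, lt_irrefl, and_false,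
        false_and, if_false, add_zero]
  rw [h1, ← Finset.diag_union_offDiag, Finset.sum_union (Finset.disjoint_diag_offDiag _), h2,
    zero_add, sum_offDiag_range, uStat]
  refine Finset.sum_congr rfl fun p hp => ?_
  rw [mem_ltPairs] at hp
  refine crossingKernel_eq_sum fun b c hbc => ?_
  have := @h (⟨p.1, hp.1.trans hp.2⟩, b) (⟨p.2, hp.2⟩, c) hbc
  simp only [Prod.mk.injEq, Fin.mk.injEq] at this
  omega

/-- The law of independent sequences of pairs of independent uniform points. -/
noncomputable def pairsLaw : Measure (ℕ → Bool → ℝ) :=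
  Measure.infinitePi fun _ => Measure.infinitePi fun _ => unitLaw

instance : IsProbabilityMeasure pairsLaw := by
  unfold pairsLaw
  infer_instance

lemma pairsLaw_map_points (n : ℕ) :
    pairsLaw.map (fun ω (p : Fin n × Bool) => ω p.1 p.2) =
      Measure.infinitePi fun _ => unitLaw := by
  have h1 : iIndepFun (fun (p : ℕ × Bool) (ω : ℕ → Bool → ℝ) => ω p.1 p.2) pairsLaw :=
    iIndepFun_uncurry_infinitePi' (X := fun _ _ x => x) (fun _ _ => unitLaw)
      fun _ _ => measurable_id
  have hinj : Function.Injective fun p : Fin n × Bool => ((p.1 : ℕ), p.2) :=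
    Fin.val_injective.prodMap Function.injective_id
  have h2 := (h1.precomp hinj).map_fun_eq_infinitePi_map fun p => by
    fun_prop
  refine h2.trans (congrArg _ (funext fun p => ?_))
  change pairsLaw.map ((fun f : Bool → ℝ => f p.2) ∘ fun ω : ℕ → Bool → ℝ => ω p.1) = unitLaw
  rw [pairsLaw, ← Measure.map_map (by fun_prop) (by fun_prop), Measure.infinitePi_map_eval,
    Measure.infinitePi_map_eval]

lemma pairsLaw_map_pair (i : ℕ) :
    pairsLaw.map (fun ω => (ω i false, ω i true)) = unitLaw.prod unitLaw := by
  have h : (fun ω : ℕ → Bool → ℝ => (ω i false, ω i true)) =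
    (fun f : Bool → ℝ => (f false, f true)) ∘ fun ω => ω i := rfl
  rw [pairsLaw, h, ← Measure.map_map (by fun_prop) (by fun_prop), Measure.infinitePi_map_eval,
    Measure.infinitePi_map_eval_prod Bool.false_ne_true]

lemma iIndepFun_pairs :
    iIndepFun (fun i (ω : ℕ → Bool → ℝ) => (ω i false, ω i true)) pairsLaw :=
  iIndepFun_infinitePi (X := fun _ (f : Bool → ℝ) => (f false, f true)) fun _ => by fun_prop

lemma measurable_pair (i : ℕ) :
    Measurable fun ω : ℕ → Bool → ℝ => (ω i false, ω i true) := by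
  fun_prop

/-- The number of crossings of a uniform chord diagram is distributed as the U-statistic with
kernel `crossingKernel` of independent pairs of independent uniform points. -/
theorem identDistrib_crossings_uStat (n : ℕ) :
    IdentDistrib (fun π => (crossings π : ℝ))
      (uStat crossingKernel (fun i (ω : ℕ → Bool → ℝ) => (ω i false, ω i true)) n)
      (uniformCD n) pairsLaw := by
  have hp : Measurable fun (ω : ℕ → Bool → ℝ) (p : Fin n × Bool) => ω p.1 p.2 := by fun_prop
  refine ⟨Measurable.of_discrete.aemeasurable,
    (measurable_uStat measurable_pair measurable_crossingKernel n).aemeasurable, ?_⟩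
  have hae : (fun ω => (crossingsAt (fun p : Fin n × Bool => ω p.1 p.2) (pairing n) : ℝ))
      =ᵐ[pairsLaw]
      uStat crossingKernel (fun i (ω : ℕ → Bool → ℝ) => (ω i false, ω i true)) n := by
    have h := ae_injective_infinitePi (I := Fin n × Bool) (P := unitLaw)
    rw [← pairsLaw_map_points] at h
    filter_upwards [ae_of_ae_map hp.aemeasurable h] with ω hω
    exact crossingsAt_pairing hω
  have h1 := infinitePi_crossingsAt (P := unitLaw) (n := n) (τ := pairing n)
    (by simp [mul_comm]) (by simp [pairing_apply]) (by simp [pairing_apply, Prod.ext_iff])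
  rw [← pairsLaw_map_points, Measure.map_map (measurable_crossingsAt _) hp] at h1
  have hc : Measurable (Nat.cast : ℕ → ℝ) := Measurable.of_discrete
  have h2 := congrArg (Measure.map (Nat.cast : ℕ → ℝ)) h1
  rw [Measure.map_map hc ((measurable_crossingsAt _).comp hp),
    Measure.map_map hc Measurable.of_discrete] at h2
  exact h2.symm.trans (Measure.map_congr hae)

end Coupling

/-- CLT for the number of crossings: the standardized number of crossings converges in
distribution to a standard normal. -/
theorem crossings_clt (μseq σseq : ℕ → ℝ)
    (hμ : ∀ n, μseq n = ∫ π, ((crossings π : ℝ)) ∂uniformCD n)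
    (hσ : ∀ n, σseq n = Real.sqrt (variance (fun π => (crossings π : ℝ)) (uniformCD n)))
    (x : ℝ) :
    Tendsto
      (fun n => ((uniformCD n) {π | ((crossings π : ℝ) - μseq n) / σseq n ≤ x}).toReal)
      atTop (nhds (((gaussianReal 0 1) (Set.Iic x)).toReal)) := by
  have hid := identDistrib_crossings_uStat
  refine (tendsto_measureReal_uStat_le measurable_pair pairsLaw_map_pair iIndepFun_pairs
    measurable_crossingKernel abs_crossingKernel_le_one crossingKernel_symm
    variance_hoeffdingProj_crossingKernel_ne_zero x).congr fun n => ?_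
  rw [hμ, hσ, (hid n).integral_eq, (hid n).variance_eq]
  exact congrArg ENNReal.toReal ((hid n).measure_mem_eq
    (((measurable_id.sub_const _).div_const _) measurableSet_Iic)).symm
end
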